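/- arXiv:1406.0154 — 5 statements merged into one kernel-verified Lean document; each statement's English description precedes it below -/
import Mathlib

section
/- Let G be a connected bipartite distance hereditary graph with color classes X and Y, having at least one edge and no universal vertices. Then the poset of maximal bicliques of G with both shores nonempty, ordered by X-shore inclusion, admits an order embedding into a product of three linearly ordered sets; that is, it has order dimension at most 3. -/
open SimpleGraph

variable {V : Type*}

/-- `X`, `Y` form a bipartition of the simple graph `G`. -/
def IsBipartition (G : SimpleGraph V) (X Y : Set V) : Prop :=
  Disjoint X Y ∧ X ∪ Y = Set.univ ∧
    ∀ ⦃u v : V⦄, G.Adj u v → (u ∈ X ∧ v ∈ Y) ∨ (u ∈ Y ∧ v ∈ X)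

/-- `G` is distance hereditary. -/
def DistHereditary (G : SimpleGraph V) : Prop :=
  ∀ (S : Set V) (u v : S), (G.induce S).Reachable u v →
    (G.induce S).dist u v = G.dist ↑u ↑v

def IsBiclique (G : SimpleGraph V) (X Y A B : Set V) : Prop :=
  A ⊆ X ∧ B ⊆ Y ∧ ∀ a ∈ A, ∀ b ∈ B, G.Adj a b

def IsMaxBiclique (G : SimpleGraph V) (X Y A B : Set V) : Prop :=
  IsBiclique G X Y A B ∧
    ∀ A' B', IsBiclique G X Y A' B' → A ⊆ A' → B ⊆ B' → A = A' ∧ B = B'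

/-- The maximal bicliques of `G` with both shores nonempty. -/
def MaxBicliques (G : SimpleGraph V) (X Y : Set V) : Set (Set V × Set V) :=
  {p | IsMaxBiclique G X Y p.1 p.2 ∧ p.1.Nonempty ∧ p.2.Nonempty}

/-- `q` covers `p` in the poset of maximal bicliques with nonempty shores,
ordered by inclusion of `X`-shores. -/
def Covers (G : SimpleGraph V) (X Y : Set V) (p q : Set V × Set V) : Prop :=
  p ∈ MaxBicliques G X Y ∧ q ∈ MaxBicliques G X Y ∧ p.1 ⊂ q.1 ∧
    ∀ r ∈ MaxBicliques G X Y, ¬ (p.1 ⊂ r.1 ∧ r.1 ⊂ q.1)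

/-- The Hasse graph of the poset of maximal bicliques with nonempty shores. -/
def HasseGraph (G : SimpleGraph V) (X Y : Set V) :
    SimpleGraph (MaxBicliques G X Y) :=
  SimpleGraph.fromRel (fun p q => Covers G X Y p.val q.val)

def NoUniversalVertex (G : SimpleGraph V) (X Y : Set V) : Prop :=
  (∀ x ∈ X, ∃ y ∈ Y, ¬ G.Adj x y) ∧ (∀ y ∈ Y, ∃ x ∈ X, ¬ G.Adj y x)

def deleteVert (G : SimpleGraph V) (v : V) : SimpleGraph V :=
  SimpleGraph.fromRel (fun a b => G.Adj a b ∧ a ≠ v ∧ b ≠ v)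

def domino : SimpleGraph (Fin 6) :=
  SimpleGraph.fromRel (fun i j => j = i + 1 ∨ (i = 0 ∧ j = 3))

def DominoFree (G : SimpleGraph V) : Prop :=
  ¬ ∃ f : Fin 6 → V, Function.Injective f ∧
      ∀ i j, domino.Adj i j ↔ G.Adj (f i) (f j)

def cycleGraph' (n : ℕ) : SimpleGraph (ZMod n) :=
  SimpleGraph.fromRel (fun i j => j = i + 1)

def HasInducedCycle (G : SimpleGraph V) (n : ℕ) : Prop :=
  ∃ f : ZMod n → V, Function.Injective f ∧
      ∀ i j, (cycleGraph' n).Adj i j ↔ G.Adj (f i) (f j)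

def Chordal (G : SimpleGraph V) : Prop := ∀ n, 4 ≤ n → ¬ HasInducedCycle G n

def Ptolemaic (G : SimpleGraph V) : Prop := Chordal G ∧ DistHereditary G

def MaxCliques (G : SimpleGraph V) : Set (Set V) :=
  {S | G.IsClique S ∧ ∀ T, G.IsClique T → S ⊆ T → S = T}

def cliqueIncidence (G : SimpleGraph V) :
    SimpleGraph (V ⊕ ↥(MaxCliques G)) :=
  SimpleGraph.fromRel (fun a b =>
    match a, b with
    | Sum.inl v, Sum.inr K => v ∈ K.val
    | _, _ => False)

def incidenceY (G : SimpleGraph V) (X Y : Set V) :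
    SimpleGraph (↥Y ⊕ ↥(MaxBicliques G X Y)) :=
  SimpleGraph.fromRel (fun a b =>
    match a, b with
    | Sum.inl y, Sum.inr B => (y : V) ∈ B.val.2
    | _, _ => False)

def incidenceX (G : SimpleGraph V) (X Y : Set V) :
    SimpleGraph (↥X ⊕ ↥(MaxBicliques G X Y)) :=
  SimpleGraph.fromRel (fun a b =>
    match a, b with
    | Sum.inl x, Sum.inr B => (x : V) ∈ B.val.1
    | _, _ => False)

def starGraph (G : SimpleGraph V) (v v' : V) : SimpleGraph (Option V) :=
  SimpleGraph.fromRel (fun a b =>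
    match a, b with
    | some a, some b => G.Adj a b
    | none, some b => G.Adj v b ∧ G.Adj v' b
    | _, _ => False)

/-- `RootedTreePoset S w`: the subposet `S` is built from singletons by repeatedly joining two
disjoint pieces by a single cover relation between their roots, keeping the first root `w`. -/
inductive RootedTreePoset {α : Type*} [PartialOrder α] : Set α → α → Prop
  | single (w : α) : RootedTreePoset {w} w
  | up {S T : Set α} {w c : α} (hS : RootedTreePoset S w) (hT : RootedTreePoset T c)
      (hle : ∀ x ∈ S, ∀ y ∈ T, x ≤ y ↔ x ≤ w ∧ c ≤ y)
      (hnle : ∀ x ∈ S, ∀ y ∈ T, ¬ y ≤ x) : RootedTreePoset (S ∪ T) w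
  | down {S T : Set α} {w c : α} (hS : RootedTreePoset S w) (hT : RootedTreePoset T c)
      (hle : ∀ x ∈ S, ∀ y ∈ T, y ≤ x ↔ y ≤ c ∧ w ≤ x)
      (hnle : ∀ x ∈ S, ∀ y ∈ T, ¬ x ≤ y) : RootedTreePoset (S ∪ T) w

namespace RootedTreePoset

variable {α β : Type*} [PartialOrder α] [PartialOrder β]

theorem root_mem {S : Set α} {w : α} (h : RootedTreePoset S w) : w ∈ S := by
  induction h with
  | single w => rfl
  | up _ _ _ _ ih _ => exact Or.inl ih
  | down _ _ _ _ ih _ => exact Or.inl ih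

theorem image {S : Set α} {w : α} (h : RootedTreePoset S w) (f : α → β)
    (hf : ∀ x ∈ S, ∀ y ∈ S, f x ≤ f y ↔ x ≤ y) : RootedTreePoset (f '' S) (f w) := by
  induction h with
  | single w => simpa using RootedTreePoset.single (f w)
  | @up S T w c hS hT hle hnle ihS ihT =>
    have hw := hS.root_mem
    have hc := hT.root_mem
    rw [Set.image_union]
    refine .up (ihS fun x hx y hy => hf x (.inl hx) y (.inl hy))
      (ihT fun x hx y hy => hf x (.inr hx) y (.inr hy)) ?_ ?_
    · rintro _ ⟨x, hx, rfl⟩ _ ⟨y, hy, rfl⟩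
      rw [hf x (.inl hx) y (.inr hy), hf x (.inl hx) w (.inl hw), hf c (.inr hc) y (.inr hy)]
      exact hle x hx y hy
    · rintro _ ⟨x, hx, rfl⟩ _ ⟨y, hy, rfl⟩
      rw [hf y (.inr hy) x (.inl hx)]
      exact hnle x hx y hy
  | @down S T w c hS hT hle hnle ihS ihT =>
    have hw := hS.root_mem
    have hc := hT.root_mem
    rw [Set.image_union]
    refine .down (ihS fun x hx y hy => hf x (.inl hx) y (.inl hy))
      (ihT fun x hx y hy => hf x (.inr hx) y (.inr hy)) ?_ ?_
    · rintro _ ⟨x, hx, rfl⟩ _ ⟨y, hy, rfl⟩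
      rw [hf y (.inr hy) x (.inl hx), hf w (.inl hw) x (.inl hx), hf y (.inr hy) c (.inr hc)]
      exact hle x hx y hy
    · rintro _ ⟨x, hx, rfl⟩ _ ⟨y, hy, rfl⟩
      rw [hf x (.inl hx) y (.inr hy)]
      exact hnle x hx y hy

/-- Attaching a new maximal element `c` covering only `u`. -/
theorem insert_above {S : Set α} {w : α} (h : RootedTreePoset S w) {u c : α} (hu : u ∈ S)
    (hle : ∀ x ∈ S, x ≤ c ↔ x ≤ u) (hnle : ∀ x ∈ S, ¬ c ≤ x) :
    RootedTreePoset (insert c S) w := by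
  induction h with
  | single w =>
    obtain rfl : u = w := hu
    rw [Set.insert_eq, Set.union_comm]
    refine .up (.single u) (.single c) ?_ ?_ <;> simp_all
  | @up S T w a hS hT h₁ h₂ ihS ihT =>
    have hw := hS.root_mem
    have ha := hT.root_mem
    rcases hu with hu | hu
    · rw [← Set.insert_union]
      refine .up (ihS hu (fun x hx => hle x (.inl hx)) fun x hx => hnle x (.inl hx)) hT ?_ ?_
      · rintro x (rfl | hx) y hy
        · simp [hnle y (.inr hy), hnle w (.inl hw)]
        · exact h₁ x hx y hy
      · rintro x (rfl | hx) y hy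
        · rw [hle y (.inr hy)]
          exact h₂ u hu y hy
        · exact h₂ x hx y hy
    · rw [← Set.union_insert]
      refine .up hS (ihT hu (fun x hx => hle x (.inr hx)) fun x hx => hnle x (.inr hx)) ?_ ?_
      · rintro x hx y (rfl | hy)
        · rw [hle x (.inl hx), hle a (.inr ha)]
          exact h₁ x hx u hu
        · exact h₁ x hx y hy
      · rintro x hx y (rfl | hy)
        · exact hnle x (.inl hx)
        · exact h₂ x hx y hy
  | @down S T w a hS hT h₁ h₂ ihS ihT =>
    have hw := hS.root_mem
    have ha := hT.root_mem
    rcases hu with hu | hu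
    · rw [← Set.insert_union]
      refine .down (ihS hu (fun x hx => hle x (.inl hx)) fun x hx => hnle x (.inl hx)) hT ?_ ?_
      · rintro x (rfl | hx) y hy
        · rw [hle y (.inr hy), hle w (.inl hw)]
          exact h₁ u hu y hy
        · exact h₁ x hx y hy
      · rintro x (rfl | hx) y hy
        · exact hnle y (.inr hy)
        · exact h₂ x hx y hy
    · rw [← Set.union_insert]
      refine .down hS (ihT hu (fun x hx => hle x (.inr hx)) fun x hx => hnle x (.inr hx)) ?_ ?_
      · rintro x hx y (rfl | hy)
        · simp [hnle x (.inl hx), hnle a (.inr ha)]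
        · exact h₁ x hx y hy
      · rintro x hx y (rfl | hy)
        · rw [hle x (.inl hx)]
          exact h₂ x hx u hu
        · exact h₂ x hx y hy

theorem dual {S : Set α} {w : α} (h : RootedTreePoset S w) :
    RootedTreePoset (OrderDual.ofDual ⁻¹' S) (OrderDual.toDual w) := by
  induction h with
  | single w => exact .single (OrderDual.toDual w)
  | up _ _ h₁ h₂ ihS ihT =>
    exact .down ihS ihT (fun x hx y hy => (h₁ _ hx _ hy).trans and_comm) h₂
  | down _ _ h₁ h₂ ihS ihT =>
    exact .up ihS ihT (fun x hx y hy => (h₁ _ hx _ hy).trans and_comm) h₂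

/-- Attaching a new minimal element `c` covered only by `u`. -/
theorem insert_below {S : Set α} {w : α} (h : RootedTreePoset S w) {u c : α} (hu : u ∈ S)
    (hle : ∀ x ∈ S, c ≤ x ↔ u ≤ x) (hnle : ∀ x ∈ S, ¬ x ≤ c) :
    RootedTreePoset (insert c S) w :=
  (h.dual.insert_above (u := OrderDual.toDual u) (c := OrderDual.toDual c) hu hle hnle).dual

/-- A tree poset has dimension at most three. -/
theorem exists_realizer {S : Set α} {w : α} (h : RootedTreePoset S w) :
    ∃ (f₁ f₂ f₃ : α → ℕ) (N : ℕ),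
      (∀ x ∈ S, f₁ x < N ∧ f₂ x < N ∧ f₃ x < N) ∧
      (∀ x ∈ S, ∀ y ∈ S, x ≤ y ↔ f₁ x ≤ f₁ y ∧ f₂ x ≤ f₂ y ∧ f₃ x ≤ f₃ y) ∧
      (∀ x ∈ S, ¬ x ≤ w → f₁ w < f₁ x) ∧ ∀ x ∈ S, ¬ w ≤ x → f₂ x < f₂ w := by
  classical
  induction h with
  | single w => exact ⟨fun _ => 0, fun _ => 0, fun _ => 0, 1, by simp_all⟩
  | @up S T w c hS hT hle hnle ihS ihT =>
    obtain ⟨f₁, f₂, f₃, M, hfM, hf, hf₁, hf₂⟩ := ihS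
    obtain ⟨g₁, g₂, g₃, N, hgN, hg, hg₁, hg₂⟩ := ihT
    have hw := hS.root_mem
    have hc := hT.root_mem
    have hST : ∀ y ∈ T, y ∉ S := fun y hy hy' => hnle y hy' y hy le_rfl
    refine ⟨fun x => if x ∈ S then (if x ≤ w then f₁ x else f₁ x + N) else g₁ x + f₁ w + 1,
      fun x => if x ∈ S then f₂ x + g₂ c else (if c ≤ x then g₂ x + M else g₂ x),
      fun x => if x ∈ S then f₃ x else g₃ x + M, M + N + 1, ?_, ?_, ?_, ?_⟩
    · grind
    · rintro x (hx | hx) y (hy | hy)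
      · grind
      · grind
      · grind
      · grind
    · grind
    · grind
  | @down S T w c hS hT hle hnle ihS ihT =>
    obtain ⟨f₁, f₂, f₃, M, hfM, hf, hf₁, hf₂⟩ := ihS
    obtain ⟨g₁, g₂, g₃, N, hgN, hg, hg₁, hg₂⟩ := ihT
    have hw := hS.root_mem
    have hc := hT.root_mem
    have hST : ∀ y ∈ T, y ∉ S := fun y hy hy' => hnle y hy' y hy le_rfl
    refine ⟨fun x => if x ∈ S then f₁ x + g₁ c + 1 else (if x ≤ c then g₁ x else g₁ x + M),
      fun x => if x ∈ S then (if w ≤ x then f₂ x + N else f₂ x) else g₂ x + f₂ w,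
      fun x => if x ∈ S then f₃ x + N else g₃ x, M + N + 1, ?_, ?_, ?_, ?_⟩
    · grind
    · rintro x (hx | hx) y (hy | hy)
      · grind
      · grind
      · grind
      · grind
    · grind
    · grind

end RootedTreePoset

/-- `v` can be reached from `r` inside `T`. -/
def ReachableIn (G : SimpleGraph V) (T : Set V) (r v : V) : Prop :=
  ∃ (hr : r ∈ T) (hv : v ∈ T), (G.induce T).Reachable ⟨r, hr⟩ ⟨v, hv⟩

theorem ReachableIn.step {G : SimpleGraph V} {T : Set V} {r v w : V} (h : ReachableIn G T r v)
    (hw : w ∈ T) (hvw : G.Adj v w) : ReachableIn G T r w := by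
  obtain ⟨hr, hv, h⟩ := h
  have hadj : (G.induce T).Adj ⟨v, hv⟩ ⟨w, hw⟩ := hvw
  exact ⟨hr, hw, h.trans hadj.reachable⟩

/-- `S` contains, with every vertex other than `r`, a neighbour which is closer to `r`. -/
def GeodesicallyRooted (G : SimpleGraph V) (r : V) (S : Set V) : Prop :=
  r ∈ S ∧ ∀ v ∈ S, v ≠ r → ∃ u ∈ S, G.Adj u v ∧ G.dist r v = G.dist r u + 1

/-- The neighbours of `v` inside `S`. -/
def nbhdIn (G : SimpleGraph V) (S : Set V) (v : V) : Set V := {u ∈ S | G.Adj v u}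

theorem GeodesicallyRooted.reachableIn {G : SimpleGraph V} {r : V} {S : Set V}
    (h : GeodesicallyRooted G r S) {v : V} (hv : v ∈ S) : ReachableIn G S r v := by
  induction hn : G.dist r v using Nat.strong_induction_on generalizing v with
  | _ n ih =>
    by_cases hvr : v = r
    · subst hvr
      exact ⟨hv, hv, .rfl⟩
    · obtain ⟨u, hu, huv, hd⟩ := h.2 v hv hvr
      exact (ih _ (by omega) hu rfl).step hv huv

theorem DistHereditary.exists_parent {G : SimpleGraph V} (hDH : DistHereditary G) {T : Set V}
    {r v : V} (h : ReachableIn G T r v) (hvr : v ≠ r) :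
    ∃ u ∈ T, G.Adj u v ∧ G.dist r v = G.dist r u + 1 := by
  obtain ⟨hr, hv, h⟩ := h
  obtain ⟨p, hp⟩ := h.symm.exists_walk_length_eq_dist
  cases p with
  | nil => exact absurd rfl hvr
  | @cons _ u _ huv q =>
    have hur : (G.induce T).Reachable ⟨r, hr⟩ u := q.reachable.symm
    have h₁ := hDH T _ _ h
    have h₂ := hDH T _ _ hur
    refine ⟨u, u.2, huv.symm, ?_⟩
    have h₃ := dist_le q
    have h₄ := huv.diff_dist_adj (u := ⟨r, hr⟩)
    rw [dist_comm] at hp h₃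
    simp only [Walk.length_cons] at hp
    simp only at h₁ h₂
    omega

theorem DistHereditary.geodesicallyRooted_univ {G : SimpleGraph V} (hDH : DistHereditary G)
    (hconn : G.Connected) (r : V) : GeodesicallyRooted G r Set.univ := by
  refine ⟨trivial, fun v _ hvr => hDH.exists_parent ⟨trivial, trivial, ?_⟩ hvr⟩
  exact (hconn.preconnected r v).map (induceUnivIso G).symm.toHom

section Pruning

variable {G : SimpleGraph V} {X Y : Set V} {r : V} {S : Set V}

theorem IsBipartition.notMem_of_mem (hbip : IsBipartition G X Y) {v : V} (hv : v ∈ X) : v ∉ Y :=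
  fun h => Set.disjoint_left.1 hbip.1 hv h

theorem IsBipartition.mem_iff_of_adj (hbip : IsBipartition G X Y) {u v : V} (h : G.Adj u v) :
    u ∈ X ↔ v ∉ X := by
  have := hbip.2.2 h
  have := @Set.disjoint_left _ X Y |>.1 hbip.1
  grind

theorem IsBipartition.swap (hbip : IsBipartition G X Y) : IsBipartition G Y X :=
  ⟨hbip.1.symm, by rw [Set.union_comm]; exact hbip.2.1, fun _ _ h => (hbip.2.2 h).symm⟩

theorem GeodesicallyRooted.mem_iff_even (hS : GeodesicallyRooted G r S)
    (hbip : IsBipartition G X Y) {v : V} (hv : v ∈ S) :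
    v ∈ X ↔ (Even (G.dist r v) ↔ r ∈ X) := by
  induction hn : G.dist r v using Nat.strong_induction_on generalizing v with
  | _ n ih =>
    by_cases hvr : v = r
    · subst hvr
      simp [← hn]
    · obtain ⟨u, hu, huv, hd⟩ := hS.2 v hv hvr
      have h₁ := ih _ (by omega) hu rfl
      have h₂ := hbip.mem_iff_of_adj huv
      rw [← hn, hd, Nat.even_add_one]
      tauto

/-- Adjacent vertices lie in consecutive distance layers. -/
theorem GeodesicallyRooted.dist_of_adj (hS : GeodesicallyRooted G r S)
    (hbip : IsBipartition G X Y) {u v : V} (hu : u ∈ S) (hv : v ∈ S) (h : G.Adj u v) :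
    G.dist r v = G.dist r u + 1 ∨ G.dist r u = G.dist r v + 1 := by
  have h₁ := hS.mem_iff_even hbip hu
  have h₂ := hS.mem_iff_even hbip hv
  have h₃ := hbip.mem_iff_of_adj h
  have h₄ := h.diff_dist_adj (u := r)
  have h₅ : G.dist r u ≠ G.dist r v := by
    intro h
    rw [h] at h₁
    tauto
  omega

/-- Two vertices of a layer with a common neighbour in the next layer have the same neighbours
in the previous layer. -/
theorem DistHereditary.adj_of_common_child (hDH : DistHereditary G)
    (hS : GeodesicallyRooted G r S) {x y v z : V} (hx : x ∈ S) (hy : y ∈ S)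
    (hv : v ∈ S) (hz : z ∈ S) (hvx : G.Adj v x) (hvy : G.Adj v y) (hzx : G.Adj z x)
    (hdz : G.dist r x = G.dist r z + 1) (hdy : G.dist r y = G.dist r x)
    (hdv : G.dist r v = G.dist r x + 1) : G.Adj z y := by
  have hz' : GeodesicallyRooted G r (insert z {t ∈ S | G.dist r t < G.dist r z}) := by
    constructor
    · by_cases h : r = z
      · exact .inl h
      · refine .inr ⟨hS.1, ?_⟩
        obtain ⟨u, -, -, hu⟩ := hS.2 z hz (Ne.symm h)
        rw [SimpleGraph.dist_self]
        omega
    · rintro t ht htr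
      have htS : t ∈ S := by rcases ht with rfl | ht; exacts [hz, ht.1]
      have htd : G.dist r t ≤ G.dist r z := by rcases ht with rfl | ht; exacts [le_rfl, ht.2.le]
      obtain ⟨u, huS, hut, hd⟩ := hS.2 t htS htr
      exact ⟨u, .inr ⟨huS, by omega⟩, hut, hd⟩
  have hreach := hz'.reachableIn (Set.mem_insert z _)
  set T := insert z {t ∈ S | G.dist r t < G.dist r z} with hT
  have hsub : T ⊆ T ∪ {x, v, y} := Set.subset_union_left
  have hreach' : ReachableIn G (T ∪ {x, v, y}) r z := by
    obtain ⟨h₁, h₂, h⟩ := hreach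
    exact ⟨hsub h₁, hsub h₂, h.map (induceHomOfLE G hsub).toHom⟩
  have hry := ((hreach'.step (w := x) (by simp) hzx).step (w := v) (by simp) hvx.symm).step
    (w := y) (by simp) hvy
  obtain ⟨u, hu, huy, hd⟩ := hDH.exists_parent hry (by
    rintro rfl
    rw [SimpleGraph.dist_self] at hdy
    omega)
  rcases hu with (rfl | hu) | rfl | rfl | rfl
  · exact huy
  · have := hu.2
    omega
  all_goals omega

/-- The neighbourhoods of two vertices of a layer in the previous layer are disjoint or nested. -/
theorem DistHereditary.nested_of_common_parent (hDH : DistHereditary G)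
    (hbip : IsBipartition G X Y) (hconn : G.Connected)
    (hS : GeodesicallyRooted G r S) {x y y' v v' : V} (hx : x ∈ S) (hy : y ∈ S)
    (hy' : y' ∈ S) (hv : v ∈ S) (hv' : v' ∈ S) (hvx : G.Adj v x) (hvx' : G.Adj v' x)
    (hvy : G.Adj v y) (hvy' : G.Adj v' y') (hdv : G.dist r v = G.dist r x + 1)
    (hdv' : G.dist r v' = G.dist r x + 1) (hdy : G.dist r y = G.dist r x)
    (hdy' : G.dist r y' = G.dist r x) : G.Adj v' y ∨ G.Adj v y' := by
  by_contra! hcon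
  obtain ⟨hn, hn'⟩ := hcon
  have hxr : x ≠ r := by
    rintro rfl
    rw [SimpleGraph.dist_self, hconn.dist_eq_zero_iff] at hdy
    exact hn (hdy ▸ hvx')
  obtain ⟨z, hz, hzx, hdz⟩ := hS.2 x hx hxr
  have hzy := hDH.adj_of_common_child hS hx hy hv hz hvx hvy hzx hdz hdy hdv
  have hzy' := hDH.adj_of_common_child hS hx hy' hv' hz hvx' hvy' hzx hdz hdy' hdv'
  have hne : y' ≠ y := by
    rintro rfl
    exact hn hvy'
  have hreach : ReachableIn G {y, v, x, v', y'} y y' :=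
    have hyy : ReachableIn G {y, v, x, v', y'} y y := ⟨by simp, by simp, .rfl⟩
    (((hyy.step (w := v) (by simp) hvy.symm).step (w := x) (by simp) hvx).step (w := v') (by simp)
      hvx'.symm).step (by simp) hvy'
  obtain ⟨u, hu, huy', hd⟩ := hDH.exists_parent hreach hne
  have hle : G.dist y y' ≤ 2 := dist_le (.cons hzy.symm (.cons hzy' .nil))
  have hlayer : ∀ a ∈ S, ∀ b ∈ S, G.dist r a = G.dist r b → ¬ G.Adj a b := by
    intro a ha b hb hab hadj
    have := hS.dist_of_adj hbip ha hb hadj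
    omega
  rcases hu with rfl | rfl | rfl | rfl | rfl
  · exact hlayer _ hy _ hy' (by omega) huy'
  · exact hn' huy'
  · exact hlayer _ hx _ hy' (by omega) huy'
  · have hpos := hconn.pos_dist_of_ne (u := y) (v := u) (by rintro rfl; omega)
    exact hn ((dist_eq_one_iff_adj.1 (by omega : G.dist y u = 1)).symm)
  · exact huy'.ne rfl

/-- A rooted set with at least two vertices has a pendant vertex or a pair of twins whose
removal leaves a rooted set. -/
theorem DistHereditary.exists_pendant_or_twins [Finite V] (hDH : DistHereditary G)
    (hbip : IsBipartition G X Y) (hconn : G.Connected) (hS : GeodesicallyRooted G r S)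
    (hnt : S.Nontrivial) :
    (∃ v ∈ S, ∃ u ∈ S, nbhdIn G S v = {u} ∧ GeodesicallyRooted G r (S \ {v}) ∧
      (S = {u, v} ∨ ∃ v' ∈ S, v' ≠ v ∧ G.Adj u v')) ∨
    ∃ x ∈ S, ∃ y ∈ S, x ≠ y ∧ nbhdIn G S x = nbhdIn G S y ∧ (nbhdIn G S x).Nonempty ∧
      GeodesicallyRooted G r (S \ {x}) := by
  obtain ⟨m, hmS, hm⟩ := S.toFinite.exists_maximalFor (G.dist r) S hnt.nonempty
  replace hm : ∀ t ∈ S, G.dist r t ≤ G.dist r m := fun t ht => by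
    by_contra! h
    exact absurd (hm ht h.le) (by omega)
  obtain ⟨v, ⟨hvS, hvm⟩, hv⟩ := ({t ∈ S | G.dist r t = G.dist r m}).toFinite.exists_minimalFor
    (fun t => (nbhdIn G S t).ncard) _ ⟨m, hmS, rfl⟩
  replace hv : ∀ t ∈ S, G.dist r t = G.dist r v →
      (nbhdIn G S v).ncard ≤ (nbhdIn G S t).ncard := fun t ht hd => by
    by_contra! h
    exact h.not_ge (hv ⟨ht, hd.trans hvm⟩ h.le)
  rw [← hvm] at hm
  have hvr : v ≠ r := by
    rintro rfl
    obtain ⟨t, ht, htv⟩ := hnt.exists_ne v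
    have := hconn.pos_dist_of_ne htv.symm
    have := hm t ht
    rw [SimpleGraph.dist_self] at this
    omega
  obtain ⟨u, hu, huv, hdu⟩ := hS.2 v hvS hvr
  have hlayer : ∀ x ∈ S, G.Adj v x → G.dist r v = G.dist r x + 1 := fun x hx hvx => by
    have := hS.dist_of_adj hbip hvS hx hvx
    have := hm x hx
    omega
  by_cases hsub : (nbhdIn G S v).Subsingleton
  · left
    refine ⟨v, hvS, u, hu, hsub.eq_singleton_of_mem ⟨hu, huv.symm⟩, ⟨⟨hS.1, hvr.symm⟩, ?_⟩, ?_⟩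
    · rintro t ⟨ht, -⟩ htr
      obtain ⟨s, hs, hst, hd⟩ := hS.2 t ht htr
      refine ⟨s, ⟨hs, ?_⟩, hst, hd⟩
      rintro rfl
      have := hm t ht
      omega
    · by_cases hur : u = r
      · subst hur
        by_contra! hcon
        apply hcon.1
        ext t
        constructor
        · intro ht
          by_contra htn
          simp only [Set.mem_insert_iff, Set.mem_singleton_iff, not_or] at htn
          refine hcon.2 t ht htn.2 ?_
          rw [← dist_eq_one_iff_adj]
          have := hm t ht
          have := hconn.pos_dist_of_ne (Ne.symm htn.1)
          rw [SimpleGraph.dist_self] at hdu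
          omega
        · rintro (rfl | rfl)
          exacts [hu, hvS]
      · obtain ⟨s, hs, hsu, hd⟩ := hS.2 u hu hur
        refine .inr ⟨s, hs, ?_, hsu.symm⟩
        rintro rfl
        omega
  · right
    obtain ⟨x, ⟨hx, hvx⟩, y, ⟨hy, hvy⟩, hxy⟩ := Set.not_subsingleton_iff.1 hsub
    have hdx := hlayer x hx hvx
    have hdy := hlayer y hy hvy
    have key : ∀ a ∈ S, ∀ b ∈ S, G.Adj v a → G.Adj v b → nbhdIn G S a ⊆ nbhdIn G S b := by
      rintro a ha b hb hva hvb t ⟨ht, hat⟩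
      refine ⟨ht, ?_⟩
      have hda := hlayer a ha hva
      have hdb := hlayer b hb hvb
      by_contra hbt
      rcases hS.dist_of_adj hbip ha ht hat with hdt | hdt
      · have hcard := hv t ht (by omega)
        have hnsub : ¬ nbhdIn G S t ⊆ nbhdIn G S v := by
          intro hsub
          have hbv : b ∈ nbhdIn G S v := ⟨hb, hvb⟩
          rw [← Set.eq_of_subset_of_ncard_le hsub hcard] at hbv
          exact hbt hbv.2.symm
        obtain ⟨c, ⟨hc, htc⟩, hcv⟩ := Set.not_subset.1 hnsub
        have hdc := hS.dist_of_adj hbip ht hc htc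
        have hmc := hm c hc
        rcases hDH.nested_of_common_parent hbip hconn hS ha hb hc hvS ht hva hat.symm hvb htc
          hda hdt (by omega) (by omega) with h | h
        · exact hbt h.symm
        · exact hcv ⟨hc, h⟩
      · exact hbt (hDH.adj_of_common_child hS ha hb hvS ht hva hvb hat.symm hdt (by omega)
          hda).symm
    have hN := (key x hx y hy hvx hvy).antisymm (key y hy x hx hvy hvx)
    have hxr : x ≠ r := by
      rintro rfl
      rw [SimpleGraph.dist_self] at hdx
      exact hxy (hconn.dist_eq_zero_iff.1 (by omega))
    refine ⟨x, hx, y, hy, hxy, hN, ⟨v, hvS, hvx.symm⟩, ⟨hS.1, hxr.symm⟩, ?_⟩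
    rintro t ⟨ht, -⟩ htr
    obtain ⟨s, hs, hst, hd⟩ := hS.2 t ht htr
    by_cases hsx : s = x
    · subst hsx
      have : t ∈ nbhdIn G S y := hN ▸ ⟨ht, hst⟩
      exact ⟨y, ⟨hy, hxy.symm⟩, this.2, by omega⟩
    · exact ⟨s, ⟨hs, hsx⟩, hst, hd⟩

end Pruning

section Shores

variable {G : SimpleGraph V} {X Y : Set V} {S : Set V}

/-- The common neighbours of `B` in `X ∩ S`. -/
def commonNbrsIn (G : SimpleGraph V) (X S B : Set V) : Set V := {x ∈ X ∩ S | ∀ y ∈ B, G.Adj x y}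

/-- The nonempty sets of common neighbours in `X ∩ S` of nonempty subsets of `Y ∩ S`. These are
the `X`-shores of the maximal bicliques of `G.induce S` with nonempty shores. -/
def shores (G : SimpleGraph V) (X Y S : Set V) : Set (Set V) :=
  {A | A.Nonempty ∧ ∃ B ⊆ Y ∩ S, B.Nonempty ∧ A = commonNbrsIn G X S B}

theorem shores_pair (hbip : IsBipartition G X Y) {x y : V} (hx : x ∈ X) (hy : y ∈ Y)
    (hxy : G.Adj x y) : shores G X Y {x, y} = {{x}} := by
  have hxY := hbip.notMem_of_mem hx
  have hyX := hbip.swap.notMem_of_mem hy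
  have hX : ∀ t ∈ X ∩ {x, y}, t = x := by
    rintro t ⟨ht, rfl | rfl⟩
    exacts [rfl, absurd ht hyX]
  have hY : ∀ t ∈ Y ∩ {x, y}, t = y := by
    rintro t ⟨ht, rfl | rfl⟩
    exacts [absurd ht hxY, rfl]
  ext A
  constructor
  · rintro ⟨hA, B, -, -, rfl⟩
    exact (Set.Nonempty.subset_singleton_iff hA).1 fun t ht => hX t ht.1
  · rintro rfl
    refine ⟨⟨x, rfl⟩, {y}, by simpa using hy, ⟨y, rfl⟩, ?_⟩
    ext t
    constructor
    · rintro rfl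
      exact ⟨⟨hx, by simp⟩, by simpa using hxy⟩
    · exact fun ht => hX t ht.1

theorem shores_diff_twin_right (hbip : IsBipartition G X Y) {v v' : V} (hv : v ∈ Y)
    (hv'S : v' ∈ S) (hv' : v' ∈ Y) (hne : v ≠ v') (hN : nbhdIn G S v = nbhdIn G S v') :
    shores G X Y S = shores G X Y (S \ {v}) := by
  classical
  have hvX := hbip.swap.notMem_of_mem hv
  have hXS : X ∩ (S \ {v}) = X ∩ S := by grind
  have hadj : ∀ x ∈ S, G.Adj x v ↔ G.Adj x v' := fun x hx => by
    have h := Set.ext_iff.1 hN x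
    simpa [nbhdIn, hx, G.adj_comm] using h
  ext A
  constructor
  · rintro ⟨hA, B, hB, hBne, rfl⟩
    by_cases hvB : v ∈ B
    · refine ⟨hA, insert v' (B \ {v}), by grind, ⟨v', by simp⟩, ?_⟩
      ext x
      simp only [commonNbrsIn, hXS, Set.mem_ofPred_eq]
      grind
    · exact ⟨hA, B, by grind, hBne, by simp only [commonNbrsIn, hXS]⟩
  · rintro ⟨hA, B, hB, hBne, rfl⟩
    exact ⟨hA, B, by grind, hBne, by simp only [commonNbrsIn, hXS]⟩

theorem rootedTreePoset_shores_of_twin_left (hbip : IsBipartition G X Y) {v v' : V} (hv : v ∈ X)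
    (hvS : v ∈ S) (hv'S : v' ∈ S) (hv' : v' ∈ X) (hne : v ≠ v')
    (hN : nbhdIn G S v = nbhdIn G S v') {w : Set V}
    (h : RootedTreePoset (shores G X Y (S \ {v})) w) :
    ∃ w', RootedTreePoset (shores G X Y S) w' := by
  classical
  have hvY := hbip.notMem_of_mem hv
  have hYS : Y ∩ (S \ {v}) = Y ∩ S := by grind
  have hadj : ∀ x ∈ S, G.Adj v x ↔ G.Adj v' x := fun x hx => by
    have h := Set.ext_iff.1 hN x
    simpa [nbhdIn, hx] using h
  have hmem : ∀ A ∈ shores G X Y (S \ {v}), v ∉ A := by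
    rintro A ⟨-, B, -, -, rfl⟩ hvA
    exact hvA.1.2.2 rfl
  let f : Set V → Set V := fun A => if v' ∈ A then insert v A else A
  have hf : ∀ B ⊆ Y ∩ S, f (commonNbrsIn G X (S \ {v}) B) = commonNbrsIn G X S B := by
    intro B hB
    have hBv : (∀ y ∈ B, G.Adj v y) ↔ ∀ y ∈ B, G.Adj v' y :=
      forall₂_congr fun y hy => hadj y (hB hy).2
    ext x
    by_cases hx : x = v
    · subst hx
      simp only [f, commonNbrsIn]
      grind
    · simp only [f, commonNbrsIn]
      grind
  have himage : f '' shores G X Y (S \ {v}) = shores G X Y S := by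
    ext A
    constructor
    · rintro ⟨A, ⟨hA, B, hB, hBne, rfl⟩, rfl⟩
      rw [hYS] at hB
      refine ⟨?_, B, hB, hBne, hf B hB⟩
      obtain ⟨a, ha⟩ := hA
      exact ⟨a, by grind⟩
    · rintro ⟨⟨a, ha⟩, B, hB, hBne, rfl⟩
      refine ⟨commonNbrsIn G X (S \ {v}) B, ⟨?_, B, hYS ▸ hB, hBne, rfl⟩, hf B hB⟩
      by_cases hav : a = v
      · subst hav
        exact ⟨v', ⟨hv', hv'S, hne.symm⟩, fun y hy => (hadj y (hB hy).2).1 (ha.2 y hy)⟩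
      · exact ⟨a, ⟨ha.1.1, ha.1.2, hav⟩, ha.2⟩
  refine ⟨f w, himage ▸ h.image f ?_⟩
  intro A hA A' hA'
  have h₁ := hmem A hA
  have h₂ := hmem A' hA'
  simp only [f, Set.subset_def]
  grind

theorem rootedTreePoset_shores_of_pendant_right (hbip : IsBipartition G X Y) {u v v' : V}
    (hv : v ∈ Y) (hvS : v ∈ S) (hu : u ∈ X) (huS : u ∈ S) (hN : nbhdIn G S v = {u})
    (hv'S : v' ∈ S) (hv' : v' ∈ Y) (hne : v' ≠ v) (hadj : G.Adj u v') {w : Set V}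
    (h : RootedTreePoset (shores G X Y (S \ {v})) w) :
    ∃ w', RootedTreePoset (shores G X Y S) w' := by
  classical
  have hvX := hbip.swap.notMem_of_mem hv
  have hXS : X ∩ (S \ {v}) = X ∩ S := by grind
  have hvadj : ∀ x ∈ S, G.Adj x v ↔ x = u := fun x hx => by
    have h := Set.ext_iff.1 hN x
    simpa [nbhdIn, hx, G.adj_comm] using h
  have heq : shores G X Y S = insert {u} (shores G X Y (S \ {v})) := by
    ext A
    constructor
    · rintro ⟨hA, B, hB, hBne, rfl⟩
      by_cases hvB : v ∈ B
      · left
        refine (Set.Nonempty.subset_singleton_iff hA).1 fun x hx => ?_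
        exact (hvadj x hx.1.2).1 (hx.2 v hvB)
      · exact .inr ⟨hA, B, by grind, hBne, by simp only [commonNbrsIn, hXS]⟩
    · rintro (rfl | ⟨hA, B, hB, hBne, rfl⟩)
      · refine ⟨⟨u, rfl⟩, {v}, by grind, ⟨v, rfl⟩, ?_⟩
        ext x
        simp only [commonNbrsIn, Set.mem_ofPred_eq]
        grind
      · exact ⟨hA, B, by grind, hBne, by simp only [commonNbrsIn, hXS]⟩
  rw [heq]
  by_cases hmem : {u} ∈ shores G X Y (S \ {v})
  · rw [Set.insert_eq_of_mem hmem]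
    exact ⟨w, h⟩
  set C := commonNbrsIn G X (S \ {v}) {y ∈ Y ∩ (S \ {v}) | G.Adj u y} with hC
  have huC : u ∈ C := ⟨by grind, fun y hy => hy.2⟩
  refine ⟨w, h.insert_below (u := C) ⟨⟨u, huC⟩, _, Set.sep_subset _ _,
    ⟨v', ⟨hv', hv'S, hne⟩, hadj⟩, rfl⟩ ?_ ?_⟩
  · rintro A ⟨hA, B, hB, hBne, rfl⟩
    constructor
    · intro hle x hx
      have huA := hle (Set.mem_singleton u)
      exact ⟨hx.1, fun y hy => hx.2 y ⟨hB hy, huA.2 y hy⟩⟩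
    · rintro hle _ rfl
      exact hle huC
  · intro A hA hle
    rw [(Set.Nonempty.subset_singleton_iff hA.1).1 hle] at hA
    exact hmem hA

theorem rootedTreePoset_shores_of_pendant_left (hbip : IsBipartition G X Y) {u v v' : V}
    (hv : v ∈ X) (hvS : v ∈ S) (hu : u ∈ Y) (huS : u ∈ S) (hN : nbhdIn G S v = {u})
    (hv'S : v' ∈ S) (hv' : v' ∈ X) (hne : v' ≠ v) (hadj : G.Adj u v') {w : Set V}
    (h : RootedTreePoset (shores G X Y (S \ {v})) w) :
    ∃ w', RootedTreePoset (shores G X Y S) w' := by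
  classical
  have hvY := hbip.notMem_of_mem hv
  have hYS : Y ∩ (S \ {v}) = Y ∩ S := by grind
  have hvadj : ∀ x ∈ S, G.Adj v x ↔ x = u := fun x hx => by
    have h := Set.ext_iff.1 hN x
    simpa [nbhdIn, hx] using h
  have hvadju := (hvadj u huS).2 rfl
  have hdel : ∀ B ⊆ Y ∩ S, B.Nonempty → B ≠ {u} →
      commonNbrsIn G X (S \ {v}) B = commonNbrsIn G X S B := by
    intro B hB hBne hBu
    have hvB : ¬ ∀ y ∈ B, G.Adj v y := fun hall =>
      hBu ((Set.Nonempty.subset_singleton_iff hBne).1 fun y hy =>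
        (hvadj y (hB hy).2).1 (hall y hy))
    ext x
    simp only [commonNbrsIn, Set.mem_ofPred_eq]
    grind
  set C := commonNbrsIn G X (S \ {v}) {u} with hC
  set D := commonNbrsIn G X S {u} with hD
  have hDC : D = insert v C := by
    ext x
    simp only [hC, hD, commonNbrsIn, Set.mem_ofPred_eq]
    grind
  have hvC : v ∉ C := fun h => h.1.2.2 rfl
  have huY : {u} ⊆ Y ∩ S := by grind
  have hCne : C.Nonempty := ⟨v', ⟨hv', hv'S, hne⟩, by simpa using hadj.symm⟩
  have hCmem : C ∈ shores G X Y (S \ {v}) := ⟨hCne, {u}, hYS ▸ huY, ⟨u, rfl⟩, rfl⟩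
  have hDmem : D ∈ shores G X Y S := ⟨⟨v, by simp [hDC]⟩, {u}, huY, ⟨u, rfl⟩, rfl⟩
  have hmem : ∀ A ∈ shores G X Y (S \ {v}), v ∉ A := by
    rintro A ⟨-, B, -, -, rfl⟩ hvA
    exact hvA.1.2.2 rfl
  have hsub : ∀ A ∈ shores G X Y S, A = D ∨ A ∈ shores G X Y (S \ {v}) := by
    rintro A ⟨hA, B, hB, hBne, rfl⟩
    by_cases hBu : B = {u}
    · exact .inl (hBu ▸ rfl)
    · rw [← hdel B hB hBne hBu] at hA ⊢
      exact .inr ⟨hA, B, hYS ▸ hB, hBne, rfl⟩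
  have hsup : ∀ A ∈ shores G X Y (S \ {v}), A = C ∨ A ∈ shores G X Y S := by
    rintro A ⟨hA, B, hB, hBne, rfl⟩
    by_cases hBu : B = {u}
    · exact .inl (hBu ▸ rfl)
    · rw [hYS] at hB
      rw [hdel B hB hBne hBu] at hA ⊢
      exact .inr ⟨hA, B, hB, hBne, rfl⟩
  by_cases hCS : C ∈ shores G X Y S
  · have heq : shores G X Y S = insert D (shores G X Y (S \ {v})) := by
      ext A
      constructor
      · exact hsub A
      · rintro (rfl | hA)
        · exact hDmem
        · rcases hsup A hA with rfl | hA
          exacts [hCS, hA]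
    rw [heq]
    refine ⟨w, h.insert_above hCmem ?_ ?_⟩
    · intro A hA
      rw [hDC]
      exact Set.subset_insert_iff_of_notMem (hmem A hA)
    · intro A hA hle
      exact hmem A hA (hle (by simp [hDC]))
  · have hCA : ∀ A ∈ shores G X Y (S \ {v}), C ⊆ A → A = C := by
      intro A hA hle
      by_contra hne
      obtain ⟨-, B, hB, hBne, rfl⟩ := id hA
      rw [hYS] at hB
      have hBu : insert u B ≠ {u} := by
        intro hBu
        refine hne (congrArg _ ((Set.Nonempty.subset_singleton_iff hBne).1 ?_))
        rw [← hBu]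
        exact Set.subset_insert u B
      have hiB : insert u B ⊆ Y ∩ S := Set.insert_subset ⟨hu, huS⟩ hB
      refine hCS ⟨hCne, insert u B, hiB, ⟨u, by simp⟩, ?_⟩
      rw [← hdel _ hiB ⟨u, by simp⟩ hBu]
      ext x
      have hx := @hle x
      simp only [hC, commonNbrsIn, Set.mem_ofPred_eq] at hx ⊢
      grind
    let f : Set V → Set V := fun A => if A = C then D else A
    have himage : f '' shores G X Y (S \ {v}) = shores G X Y S := by
      ext A
      constructor
      · rintro ⟨A, hA, rfl⟩
        by_cases hAC : A = C
        · simpa [f, hAC] using hDmem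
        · simpa [f, hAC] using (hsup A hA).resolve_left hAC
      · intro hA
        rcases hsub A hA with rfl | hA'
        · exact ⟨C, hCmem, by simp [f]⟩
        · refine ⟨A, hA', ?_⟩
          have hAC : A ≠ C := by
            rintro rfl
            exact hCS hA
          simp [f, hAC]
    refine ⟨f w, himage ▸ h.image f ?_⟩
    intro A hA A' hA'
    have h₁ := hmem A hA
    have h₂ := hmem A' hA'
    have hCA' := hCA A' hA'
    simp only [f]
    by_cases hAC : A = C <;> by_cases hAC' : A' = C
    · simp [hAC, hAC']
    · subst hAC
      simp only [if_true, hAC', if_false]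
      refine ⟨fun hle => absurd (hle (by simp [hDC])) h₂, fun hle => absurd (hCA' hle) hAC'⟩
    · simp only [hAC, hAC', if_true, if_false]
      rw [hDC]
      exact Set.subset_insert_iff_of_notMem h₁
    · simp [hAC, hAC']

theorem DistHereditary.rootedTreePoset_shores [Finite V] (hDH : DistHereditary G)
    (hbip : IsBipartition G X Y) (hconn : G.Connected) {r : V} (hS : GeodesicallyRooted G r S)
    (hnt : S.Nontrivial) : ∃ w, RootedTreePoset (shores G X Y S) w := by
  induction S using WellFoundedLT.induction with
  | _ S ih =>
  have hside : ∀ {s t}, G.Adj s t → (s ∈ X ∧ t ∈ Y) ∨ (s ∈ Y ∧ t ∈ X) := fun h => hbip.2.2 h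
  have hX : ∀ {t}, t ∈ X → t ∉ Y := hbip.notMem_of_mem
  have hlt : ∀ v ∈ S, S \ {v} < S := fun v hv => Set.sdiff_singleton_ssubset.2 hv
  rcases hDH.exists_pendant_or_twins hbip hconn hS hnt with
    ⟨v, hv, u, hu, hN, hS', h⟩ | ⟨x, hx, y, hy, hxy, hN, ⟨t, ht, hxt⟩, hS'⟩
  · have hvu : G.Adj v u := (hN ▸ Set.mem_singleton u : u ∈ nbhdIn G S v).2
    rcases h with rfl | ⟨v', hv', hne, huv'⟩
    · rcases hside hvu with ⟨h₁, h₂⟩ | ⟨h₁, h₂⟩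
      · rw [Set.pair_comm, shores_pair hbip h₁ h₂ hvu]
        exact ⟨_, .single _⟩
      · rw [shores_pair hbip h₂ h₁ hvu.symm]
        exact ⟨_, .single _⟩
    · obtain ⟨w, hw⟩ := ih _ (hlt v hv) hS' ⟨u, ⟨hu, hvu.ne'⟩, v', ⟨hv', hne⟩, huv'.ne⟩
      rcases hside hvu with ⟨h₁, h₂⟩ | ⟨h₁, h₂⟩
      · exact rootedTreePoset_shores_of_pendant_left hbip h₁ hv h₂ hu hN hv'
          ((hside huv').resolve_left fun h => hX h.1 h₂).2 hne huv' hw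
      · exact rootedTreePoset_shores_of_pendant_right hbip h₁ hv h₂ hu hN hv'
          ((hside huv').resolve_right fun h => hX h₂ h.1).2 hne huv' hw
  · have hyt : G.Adj y t := (hN ▸ ⟨ht, hxt⟩ : t ∈ nbhdIn G S y).2
    obtain ⟨w, hw⟩ := ih _ (hlt x hx) hS' ⟨y, ⟨hy, hxy.symm⟩, t, ⟨ht, hxt.ne'⟩, hyt.ne⟩
    rcases hside hxt with ⟨h₁, h₂⟩ | ⟨h₁, h₂⟩
    · exact rootedTreePoset_shores_of_twin_left hbip h₁ hx hy
        ((hside hyt).resolve_right fun h => hX h.2 h₂).1 hxy hN hw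
    · rw [shores_diff_twin_right hbip h₁ hy
        ((hside hyt).resolve_left fun h => hX h₂ h.2).1 hxy hN]
      exact ⟨w, hw⟩

theorem fst_mem_shores_of_mem_maxBicliques {p : Set V × Set V} (hp : p ∈ MaxBicliques G X Y) :
    p.1 ∈ shores G X Y Set.univ := by
  obtain ⟨⟨⟨h₁, h₂, h₃⟩, hmax⟩, hA, hB⟩ := hp
  refine ⟨hA, p.2, by simpa using h₂, hB, ?_⟩
  refine (hmax (commonNbrsIn G X Set.univ p.2) p.2 ⟨fun x hx => hx.1.1, h₂, fun x hx => hx.2⟩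
    (fun x hx => ⟨⟨h₁ hx, trivial⟩, h₃ x hx⟩) subset_rfl).1

end Shores

/-- The poset of maximal bicliques (with nonempty shores) of a
connected BDH graph with an edge and no universal vertices, ordered by
`X`-shore inclusion, has order dimension at most 3. -/
theorem maxBiclique_poset_dim_le_three [Fintype V] (G : SimpleGraph V)
    (X Y : Set V) (hbip : IsBipartition G X Y) (hDH : DistHereditary G)
    (hconn : G.Connected) (hedge : ∃ u v, G.Adj u v)
    (huniv : NoUniversalVertex G X Y) :
    ∃ (L₁ L₂ L₃ : Type) (_ : LinearOrder L₁) (_ : LinearOrder L₂)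
      (_ : LinearOrder L₃)
      (f : ↥(MaxBicliques G X Y) → L₁ × L₂ × L₃),
      ∀ p q : ↥(MaxBicliques G X Y), p.val.1 ⊆ q.val.1 ↔ f p ≤ f q := by
  obtain ⟨r, s, hrs⟩ := hedge
  obtain ⟨w, hw⟩ := hDH.rootedTreePoset_shores hbip hconn
    (hDH.geodesicallyRooted_univ hconn r) ⟨r, trivial, s, trivial, hrs.ne⟩
  obtain ⟨f₁, f₂, f₃, -, -, hf, -⟩ := hw.exists_realizer
  refine ⟨ℕ, ℕ, ℕ, inferInstance, inferInstance, inferInstance,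
    fun p => (f₁ p.val.1, f₂ p.val.1, f₃ p.val.1), fun p q => ?_⟩
  exact hf _ (fst_mem_shores_of_mem_maxBicliques p.2) _ (fst_mem_shores_of_mem_maxBicliques q.2)
end

section
/- Let G be a bipartite distance hereditary graph with color classes X and Y. Let G_X be the graph on vertex set X in which distinct x, x' are adjacent iff they have a common neighbor in Y (the 2-section of the neighborhood hypergraph of G on X), and let G_Y be the graph on vertex set Y in which distinct y, y' are adjacent iff they have a common neighbor in X. Then both G_X and G_Y are Ptolemaic, i.e., both chordal and distance hereditary. -/
open SimpleGraph

variable {V : Type*}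

/-- The 2-section of the neighborhood hypergraph: distinct vertices of `X`
are adjacent iff they have a common neighbor in `Y`. -/
def twoSection (G : SimpleGraph V) (X Y : Set V) : SimpleGraph ↥X :=
  SimpleGraph.fromRel (fun a b => ∃ y ∈ Y, G.Adj ↑a y ∧ G.Adj ↑b y)

theorem IsBipartition.symm {G : SimpleGraph V} {X Y : Set V} (h : IsBipartition G X Y) :
    IsBipartition G Y X :=
  ⟨h.1.symm, by rw [Set.union_comm]; exact h.2.1, fun _ _ e => (h.2.2 e).symm⟩

theorem IsBipartition.not_adj {G : SimpleGraph V} {X Y : Set V} (h : IsBipartition G X Y)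
    {u v : V} (hu : u ∈ X) (hv : v ∈ X) : ¬ G.Adj u v := fun e => by
  rcases h.2.2 e with ⟨_, h'⟩ | ⟨h', _⟩
  · exact Set.disjoint_left.1 h.1 hv h'
  · exact Set.disjoint_left.1 h.1 hu h'

theorem twoSection_adj {G : SimpleGraph V} {X Y : Set V} {a b : X} :
    (twoSection G X Y).Adj a b ↔ a ≠ b ∧ ∃ y ∈ Y, G.Adj a y ∧ G.Adj b y := by
  simp only [twoSection, SimpleGraph.fromRel_adj]
  grind

/-- A walk in the 2-section lifts to a walk of twice the length. -/
theorem exists_walk_of_twoSection_walk {G : SimpleGraph V} {X Y : Set V} {a b : X}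
    (p : (twoSection G X Y).Walk a b) :
    ∃ q : G.Walk (a : V) b, q.length = 2 * p.length := by
  induction p with
  | nil => exact ⟨.nil, rfl⟩
  | cons h p ih =>
    obtain ⟨q, hq⟩ := ih
    obtain ⟨_, y, _, h₁, h₂⟩ := twoSection_adj.1 h
    refine ⟨.cons h₁ (.cons h₂.symm q), ?_⟩
    simp only [SimpleGraph.Walk.length_cons, hq]
    ring

/-- In a distance hereditary graph, the ends of an induced path
`x 0, y 0, x 1, …, y (k - 1), x k` are at distance `2 * k`. -/
theorem DistHereditary.dist_eq_of_alternating {G : SimpleGraph V} {X Y : Set V}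
    (hbip : IsBipartition G X Y) (hDH : DistHereditary G) (k : ℕ) (x y : ℕ → V)
    (hx : ∀ i ≤ k, x i ∈ X) (hy : ∀ j < k, y j ∈ Y)
    (hinj : ∀ i ≤ k, ∀ j ≤ k, x i = x j → i = j)
    (hadj : ∀ i ≤ k, ∀ j < k, G.Adj (x i) (y j) ↔ i = j ∨ i = j + 1) :
    G.dist (x 0) (x k) = 2 * k := by
  let S : Set V := {v | (∃ i ≤ k, v = x i) ∨ ∃ j < k, v = y j}
  let P : V → ℕ → Prop := fun v m =>
    (∃ i ≤ k, v = x i ∧ m = 2 * i) ∨ ∃ j < k, v = y j ∧ m = 2 * j + 1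
  have hxS : ∀ i ≤ k, x i ∈ S := fun i hi => .inl ⟨i, hi, rfl⟩
  have hyS : ∀ j < k, y j ∈ S := fun j hj => .inr ⟨j, hj, rfl⟩
  have hxy : ∀ i ≤ k, ∀ j < k, x i ≠ y j := fun i hi j hj h =>
    Set.disjoint_left.1 hbip.1 (hx i hi) (h ▸ hy j hj)
  have hyinj : ∀ i < k, ∀ j < k, y i = y j → i = j := by
    intro i hi j hj h
    have h₁ := (hadj i hi.le i hi).2 (.inl rfl)
    have h₂ := (hadj (i + 1) hi i hi).2 (.inr rfl)
    rw [h] at h₁ h₂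
    have h₃ := (hadj i hi.le j hj).1 h₁
    have h₄ := (hadj (i + 1) hi j hj).1 h₂
    omega
  have hP : ∀ v m m', P v m → P v m' → m = m' := by
    rintro v m m' (⟨i, hi, rfl, rfl⟩ | ⟨i, hi, rfl, rfl⟩) (⟨j, hj, h, rfl⟩ | ⟨j, hj, h, rfl⟩)
    · rw [hinj i hi j hj h]
    · exact (hxy i hi j hj h).elim
    · exact (hxy j hj i hi h.symm).elim
    · rw [hyinj i hi j hj h]
  have hstep : ∀ u v m m', G.Adj u v → P u m → P v m' → m' ≤ m + 1 := by
    rintro u v m m' e (⟨i, hi, rfl, rfl⟩ | ⟨i, hi, rfl, rfl⟩) (⟨j, hj, rfl, rfl⟩ | ⟨j, hj, rfl, rfl⟩)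
    · exact (hbip.not_adj (hx i hi) (hx j hj) e).elim
    · have := (hadj i hi j hj).1 e
      omega
    · have := (hadj j hj i hi).1 e.symm
      omega
    · exact (hbip.symm.not_adj (hy i hi) (hy j hj) e).elim
  have hPS : ∀ v : S, ∃ m, P v m := by
    rintro ⟨v, ⟨i, hi, h⟩ | ⟨j, hj, h⟩⟩
    · exact ⟨_, .inl ⟨i, hi, h, rfl⟩⟩
    · exact ⟨_, .inr ⟨j, hj, h, rfl⟩⟩
  have hwalk : ∀ (u v : S) (p : (G.induce S).Walk u v) (m m' : ℕ),
      P u m → P v m' → m' ≤ m + p.length := by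
    intro u v p
    induction p with
    | nil => intro m m' h h'; exact (hP _ _ _ h' h).le
    | @cons u w v e p ih =>
      intro m m' h h'
      obtain ⟨l, hl⟩ := hPS w
      have h₁ := hstep _ _ _ _ e h hl
      have h₂ := ih _ _ hl h'
      rw [SimpleGraph.Walk.length_cons]
      omega
  have hpath : ∀ i (hi : i ≤ k), ∃ p : (G.induce S).Walk ⟨x 0, hxS 0 (Nat.zero_le k)⟩ ⟨x i, hxS i hi⟩,
      p.length = 2 * i := by
    intro i
    induction i with
    | zero => intro _; exact ⟨.nil, rfl⟩
    | succ i ih =>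
      intro hi
      obtain ⟨p, hp⟩ := ih (by omega)
      have e₁ : (G.induce S).Adj ⟨x i, hxS i (by omega)⟩ ⟨y i, hyS i hi⟩ :=
        (hadj i (by omega) i hi).2 (.inl rfl)
      have e₂ : (G.induce S).Adj ⟨y i, hyS i hi⟩ ⟨x (i + 1), hxS _ hi⟩ :=
        ((hadj (i + 1) hi i hi).2 (.inr rfl)).symm
      refine ⟨(p.concat e₁).concat e₂, ?_⟩
      simp only [SimpleGraph.Walk.length_concat, hp]
      ring
  obtain ⟨p, hp⟩ := hpath k le_rfl
  rw [← hDH S _ _ p.reachable]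
  refine le_antisymm (hp ▸ SimpleGraph.dist_le p) ?_
  obtain ⟨q, hq⟩ := p.reachable.exists_walk_length_eq_dist
  have := hwalk _ _ q 0 (2 * k) (.inl ⟨0, Nat.zero_le k, rfl, rfl⟩) (.inl ⟨k, le_rfl, rfl, rfl⟩)
  omega

theorem twoSection_chordal {G : SimpleGraph V} {X Y : Set V}
    (hbip : IsBipartition G X Y) (hDH : DistHereditary G) : Chordal (twoSection G X Y) := by
  rintro n hn ⟨f, hf, hc⟩
  have hcast : ∀ i < n, ∀ j < n, (i : ZMod n) = j → i = j := by
    intro i hi j hj h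
    rw [ZMod.natCast_eq_natCast_iff'] at h
    rwa [Nat.mod_eq_of_lt hi, Nat.mod_eq_of_lt hj] at h
  have hsmall : ∀ m : ℕ, 0 < m → m < n → (m : ZMod n) ≠ 0 := fun m h₀ h h' =>
    h₀.ne' (hcast m h 0 (by omega) (by simpa using h'))
  have h1 : (1 : ZMod n) ≠ 0 := by simpa using hsmall 1 (by omega) (by omega)
  have h3 : (3 : ZMod n) ≠ 0 := by simpa using hsmall 3 (by omega) (by omega)
  have hcyc : ∀ i j : ZMod n, (cycleGraph' n).Adj i j ↔ i ≠ j ∧ (j = i + 1 ∨ i = j + 1) :=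
    fun i j => SimpleGraph.fromRel_adj _ _ _
  have hsucc : ∀ i : ZMod n, (twoSection G X Y).Adj (f i) (f (i + 1)) := fun i =>
    (hc _ _).1 ((hcyc _ _).2 ⟨fun h => h1 (by linear_combination -h), .inl rfl⟩)
  choose y hyY hy using fun i => (twoSection_adj.1 (hsucc i)).2
  have hnadj : ∀ i j : ZMod n, G.Adj (f j) (y i) → j = i ∨ j = i + 1 := by
    intro i j h
    by_contra! hne
    have h₁ := (hcyc _ _).1 ((hc i j).2
      (twoSection_adj.2 ⟨fun e => hne.1 (hf e).symm, y i, hyY i, (hy i).1, h⟩))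
    have h₂ := (hcyc _ _).1 ((hc (i + 1) j).2
      (twoSection_adj.2 ⟨fun e => hne.2 (hf e).symm, y i, hyY i, (hy i).2, h⟩))
    have h₃ := h₁.2.resolve_left hne.2
    have h₄ := h₂.2.resolve_right fun e => hne.1 (by linear_combination -e)
    exact h3 (by linear_combination -h₃ - h₄)
  have hdist := hDH.dist_eq_of_alternating hbip (n - 1) (fun i => (f i : V)) (fun i => y i)
    (fun i _ => (f i).2) (fun i _ => hyY i)
    (fun i hi j hj h => hcast i (by omega) j (by omega) (hf (Subtype.ext h))) (by
      intro i hi j hj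
      constructor
      · intro h
        rcases hnadj _ _ h with h | h
        · exact .inl (hcast i (by omega) j (by omega) h)
        · exact .inr (hcast i (by omega) (j + 1) (by omega) (by exact_mod_cast h))
      · rintro (rfl | rfl)
        · exact (hy _).1
        · simpa using (hy j).2)
  have hlast : ((n - 1 : ℕ) : ZMod n) + 1 = 0 := by
    rw [← Nat.cast_add_one, Nat.sub_add_cancel (by omega), ZMod.natCast_self]
  have hy' := hy ((n - 1 : ℕ) : ZMod n)
  rw [hlast] at hy'
  have hle := SimpleGraph.dist_le (SimpleGraph.Walk.cons hy'.2 (.cons hy'.1.symm .nil))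
  simp only [SimpleGraph.Walk.length_cons, SimpleGraph.Walk.length_nil] at hle
  simp only [Nat.cast_zero] at hdist
  omega

theorem twoSection_distHereditary {G : SimpleGraph V} {X Y : Set V}
    (hbip : IsBipartition G X Y) (hDH : DistHereditary G) :
    DistHereditary (twoSection G X Y) := by
  intro S u v huv
  obtain ⟨p, hp⟩ := huv.exists_walk_length_eq_dist
  set k := p.length with hk
  have hmap := SimpleGraph.dist_le (p.map (SimpleGraph.Embedding.induce S).toHom)
  rw [SimpleGraph.Walk.length_map] at hmap
  have hreach : (twoSection G X Y).Reachable (u : X) v :=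
    (p.map (SimpleGraph.Embedding.induce S).toHom).reachable
  obtain ⟨q, hq⟩ := hreach.exists_walk_length_eq_dist
  obtain ⟨r, hr⟩ := exists_walk_of_twoSection_walk q
  have hinj : ∀ i ≤ k, ∀ j ≤ k, p.getVert i = p.getVert j → i = j := fun i hi j hj h =>
    (p.isPath_of_length_eq_dist hp).getVert_injOn hi hj h
  have hshort : ∀ i j, i ≤ k → j ≤ k →
      ((twoSection G X Y).induce S).Adj (p.getVert i) (p.getVert j) → j ≤ i + 1 := by
    intro i j hi hj e
    have := SimpleGraph.dist_le ((p.take i).append (.cons e (p.drop j)))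
    simp only [SimpleGraph.Walk.length_append, SimpleGraph.Walk.length_cons,
      SimpleGraph.Walk.take_length, SimpleGraph.Walk.drop_length] at this
    omega
  have hex : ∀ i, ∃ y, i < k → y ∈ Y ∧ G.Adj (p.getVert i : X) y ∧
      G.Adj (p.getVert (i + 1) : X) y := by
    intro i
    by_cases hi : i < k
    · obtain ⟨_, y, hy⟩ := twoSection_adj.1 (p.adj_getVert_succ hi)
      exact ⟨y, fun _ => hy⟩
    · exact ⟨(u : X), fun h => (hi h).elim⟩
  choose y hy using hex
  have hclose : ∀ i ≤ k, ∀ j ≤ k, ∀ z ∈ Y, G.Adj (p.getVert i : X) z →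
      G.Adj (p.getVert j : X) z → j ≤ i + 1 := by
    intro i hi j hj z hz h₁ h₂
    by_cases hij : i = j
    · omega
    · exact hshort i j hi hj (twoSection_adj.2
        ⟨fun e => hij (hinj i hi j hj (Subtype.ext e)), z, hz, h₁, h₂⟩)
  have hdist := hDH.dist_eq_of_alternating hbip k (fun i => ((p.getVert i : X) : V)) y
    (fun i _ => (p.getVert i : X).2) (fun j hj => (hy j hj).1)
    (fun i hi j hj h => hinj i hi j hj (Subtype.ext (Subtype.ext h))) (by
      intro i hi j hj
      obtain ⟨hY, h₁, h₂⟩ := hy j hj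
      constructor
      · intro h
        have := hclose j hj.le i hi _ hY h₁ h
        have := hclose i hi (j + 1) hj _ hY h h₂
        omega
      · rintro (rfl | rfl)
        exacts [h₁, h₂])
  simp only [hk, SimpleGraph.Walk.getVert_zero, SimpleGraph.Walk.getVert_length] at hdist
  have hle := SimpleGraph.dist_le r
  have hmap' : (twoSection G X Y).dist (u : X) v ≤ k := hmap
  omega

/-- For a BDH graph, the 2-sections of both neighborhood
hypergraphs are Ptolemaic (chordal and distance hereditary). -/
theorem twoSections_ptolemaic [Fintype V] (G : SimpleGraph V) (X Y : Set V)
    (hbip : IsBipartition G X Y) (hDH : DistHereditary G) :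
    Ptolemaic (twoSection G X Y) ∧ Ptolemaic (twoSection G Y X) := by
  exact ⟨⟨twoSection_chordal hbip hDH, twoSection_distHereditary hbip hDH⟩,
    twoSection_chordal hbip.symm hDH, twoSection_distHereditary hbip.symm hDH⟩
end

section
/- Let G be a Ptolemaic graph (chordal and distance hereditary) and let K(G) be the set of its maximal cliques. Then the vertex-clique incidence bipartite graph of G — the bipartite graph with color classes V(G) and K(G) in which a vertex v is adjacent to a maximal clique K iff v ∈ K — is bipartite distance hereditary. -/
open SimpleGraph

variable {V : Type*}

/-- The sequence `p 0, …, p n` is an induced path of `G`. -/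
def IsInducedPath (G : SimpleGraph V) (p : ℕ → V) (n : ℕ) : Prop :=
  (∀ i ≤ n, ∀ j ≤ n, p i = p j → i = j) ∧
    ∀ i ≤ n, ∀ j ≤ n, (G.Adj (p i) (p j) ↔ j = i + 1 ∨ i = j + 1)

namespace IsInducedPath

variable {G : SimpleGraph V} {p : ℕ → V} {n : ℕ}

theorem adj_succ (h : IsInducedPath G p n) {i : ℕ} (hi : i < n) : G.Adj (p i) (p (i + 1)) :=
  (h.2 i hi.le (i + 1) hi).2 (Or.inl rfl)

theorem shift (h : IsInducedPath G p n) {k m : ℕ} (hm : k + m ≤ n) :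
    IsInducedPath G (fun i => p (k + i)) m := by
  refine ⟨fun i hi j hj hij => ?_, fun i hi j hj => ?_⟩
  · have := h.1 (k + i) (by omega) (k + j) (by omega) hij
    omega
  · rw [h.2 (k + i) (by omega) (k + j) (by omega)]
    omega

theorem reverse (h : IsInducedPath G p n) : IsInducedPath G (fun i => p (n - i)) n := by
  refine ⟨fun i hi j hj hij => ?_, fun i hi j hj => ?_⟩
  · have := h.1 (n - i) (by omega) (n - j) (by omega) hij
    omega
  · rw [h.2 (n - i) (by omega) (n - j) (by omega)]
    omega

end IsInducedPath

theorem SimpleGraph.Walk.potential_le {G : SimpleGraph V} {f : V → ℕ}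
    (hf : ∀ a b, G.Adj a b → f b ≤ f a + 1) {a b : V} (w : G.Walk a b) :
    f b ≤ f a + w.length := by
  induction w with
  | nil => simp
  | cons h w ih =>
    have := hf _ _ h
    rw [Walk.length_cons]
    omega

theorem DistHereditary.le_length {G : SimpleGraph V} (hG : DistHereditary G) {p : ℕ → V} {n : ℕ}
    (h : IsInducedPath G p n) (w : G.Walk (p 0) (p n)) : n ≤ w.length := by
  set S : Set V := {x | ∃ i ≤ n, p i = x}
  have hmem : ∀ i ≤ n, p i ∈ S := fun i hi => ⟨i, hi, rfl⟩
  have hreach : ∀ i (hi : i ≤ n),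
      (G.induce S).Reachable ⟨p 0, hmem 0 (Nat.zero_le n)⟩ ⟨p i, hmem i hi⟩ := by
    intro i
    induction i with
    | zero => exact fun _ => Reachable.refl _
    | succ i ih =>
      intro hi
      refine (ih (by omega)).trans (Adj.reachable ?_)
      exact h.adj_succ (by omega)
  choose f hf using fun x : S => x.2
  have hpot : ∀ a b, (G.induce S).Adj a b → f b ≤ f a + 1 := by
    intro a b hab
    have hab' : G.Adj (p (f a)) (p (f b)) := by
      rw [(hf a).2, (hf b).2]; exact hab
    have := (h.2 _ (hf a).1 _ (hf b).1).1 hab'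
    omega
  have hfi : ∀ i (hi : i ≤ n), f ⟨p i, hmem i hi⟩ = i := fun i hi =>
    h.1 _ (hf _).1 _ hi (hf _).2
  obtain ⟨q, hq⟩ := (hreach n le_rfl).exists_walk_length_eq_dist
  have hle := q.potential_le hpot
  rw [hfi n le_rfl, hfi 0 (Nat.zero_le n), hq, hG S _ _ (hreach n le_rfl)] at hle
  have : G.dist (p 0) (p n) ≤ w.length := dist_le w
  simp only at hle
  omega

theorem distHereditary_of_le_length {G : SimpleGraph V}
    (hG : ∀ (p : ℕ → V) (n : ℕ), IsInducedPath G p n →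
      ∀ w : G.Walk (p 0) (p n), n ≤ w.length) : DistHereditary G := by
  intro S u v huv
  obtain ⟨q, hq⟩ := huv.exists_walk_length_eq_dist
  have hshort : ∀ i j, i ≤ j → j ≤ q.length →
      ∀ r : (G.induce S).Walk (q.getVert i) (q.getVert j), j ≤ i + r.length := by
    intro i j hij hj r
    have h := dist_le (((q.take i).append r).append (q.drop j))
    rw [← hq] at h
    simp only [Walk.length_append, Walk.take_length, Walk.drop_length] at h
    omega
  have hadj : ∀ i < q.length, (G.induce S).Adj (q.getVert i) (q.getVert (i + 1)) :=
    fun i hi => q.adj_getVert_succ hi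
  have hpath : IsInducedPath G (fun i => (q.getVert i : V)) q.length := by
    refine ⟨?_, ?_⟩
    · have key : ∀ i j, i ≤ j → j ≤ q.length → q.getVert i = q.getVert j → j ≤ i := by
        intro i j hij hj he
        simpa using hshort i j hij hj (Walk.nil.copy rfl he)
      intro i hi j hj he
      have he' : q.getVert i = q.getVert j := Subtype.ext he
      rcases le_total i j with hij | hij
      · exact le_antisymm hij (key i j hij hj he')
      · exact le_antisymm (key j i hij hi he'.symm) hij
    · have key : ∀ i j, i ≤ j → j ≤ q.length →
          (G.induce S).Adj (q.getVert i) (q.getVert j) → j = i + 1 := by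
        intro i j hij hj ha
        have h := hshort i j hij hj ha.toWalk
        have hne : i ≠ j := by
          rintro rfl
          exact ha.ne rfl
        simp only [Walk.length_cons, Walk.length_nil] at h
        omega
      intro i hi j hj
      refine ⟨fun ha => ?_, ?_⟩
      · rcases le_total i j with hij | hij
        · exact Or.inl (key i j hij hj ha)
        · exact Or.inr (key j i hij hi (Adj.symm ha))
      · rintro (rfl | rfl)
        · exact hadj i (by omega)
        · exact (hadj j (by omega)).symm
  have hreach : G.Reachable (u : V) (v : V) :=
    huv.map (Embedding.induce S).toHom
  refine le_antisymm ?_ ?_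
  · obtain ⟨w, hw⟩ := hreach.exists_walk_length_eq_dist
    have := hG _ _ hpath (w.copy (by simp) (by simp))
    rw [Walk.length_copy] at this
    omega
  · rw [← hq, ← Walk.length_map (Embedding.induce S).toHom q]
    exact dist_le _

theorem Chordal.not_four_cycle {G : SimpleGraph V} (hG : Chordal G) {a b c d : V}
    (hab : G.Adj a b) (hbc : G.Adj b c) (hcd : G.Adj c d) (hda : G.Adj d a)
    (hac : a ≠ c) (hbd : b ≠ d) (nac : ¬ G.Adj a c) (nbd : ¬ G.Adj b d) : False := by
  refine hG 4 le_rfl ⟨(![a, b, c, d] : Fin 4 → V), ?_, ?_⟩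
  · intro (i : Fin 4) (j : Fin 4) hij
    fin_cases i <;> fin_cases j <;> try rfl
    all_goals
      simp_all [hab.ne, hab.ne', hbc.ne, hbc.ne', hcd.ne, hcd.ne', hda.ne, hda.ne', hac.symm,
        hbd.symm]
  · have hdec : ∀ i j : Fin 4, (cycleGraph' 4).Adj i j ↔ i ≠ j ∧ (j = i + 1 ∨ i = j + 1) :=
      fun i j => Iff.rfl
    intro (i : Fin 4) (j : Fin 4)
    rw [hdec]
    have := hab.symm
    have := hbc.symm
    have := hcd.symm
    have := hda.symm
    have : ¬ G.Adj c a := fun h => nac h.symm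
    have : ¬ G.Adj d b := fun h => nbd h.symm
    fin_cases i <;> fin_cases j <;> simp [*]

theorem DistHereditary.not_gem {G : SimpleGraph V} (hG : DistHereditary G) {a b c d x : V}
    (hab : G.Adj a b) (hbc : G.Adj b c) (hcd : G.Adj c d)
    (nac : ¬ G.Adj a c) (nbd : ¬ G.Adj b d) (nad : ¬ G.Adj a d)
    (hxa : G.Adj x a) (hxd : G.Adj x d) : False := by
  have nca : ¬ G.Adj c a := fun h => nac h.symm
  have ndb : ¬ G.Adj d b := fun h => nbd h.symm
  have nda : ¬ G.Adj d a := fun h => nad h.symm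
  have hba := hab.symm
  have hcb := hbc.symm
  have hdc := hcd.symm
  have hac : a ≠ c := by rintro rfl; exact nad hcd
  have hbd : b ≠ d := by rintro rfl; exact nad hab
  have had : a ≠ d := by rintro rfl; exact nac hdc
  let p : ℕ → V := fun i => match i with
    | 0 => a
    | 1 => b
    | 2 => c
    | _ => d
  have hp : IsInducedPath G p 3 := by
    refine ⟨?_, ?_⟩
    · intro i hi j hj hij
      interval_cases i <;> interval_cases j <;>
        simp_all [p, hab.ne, hab.ne', hbc.ne, hbc.ne', hcd.ne, hcd.ne', hac.symm, hbd.symm,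
          had.symm]
    · intro i hi j hj
      interval_cases i <;> interval_cases j <;> simp [p, *]
  have := hG.le_length hp (Walk.cons hxa.symm (Walk.cons hxd Walk.nil))
  simp at this

theorem exists_mem_not_adj_of_notMem {G : SimpleGraph V} {K : Set V} (hK : K ∈ MaxCliques G)
    {v : V} (hv : v ∉ K) : ∃ w ∈ K, ¬ G.Adj w v := by
  by_contra! h
  have hc : G.IsClique (insert v K) :=
    isClique_insert.2 ⟨hK.1, fun b hb _ => (h b hb).symm⟩
  have := hK.2 _ hc (Set.subset_insert v K)
  exact hv (this ▸ Set.mem_insert v K)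

theorem Ptolemaic.isInducedPath_of_cliques {G : SimpleGraph V} (hG : Ptolemaic G)
    {v : ℕ → V} {K : ℕ → Set V} {n : ℕ} (hK : ∀ i < n, K i ∈ MaxCliques G)
    (hinj : ∀ i ≤ n, ∀ j ≤ n, v i = v j → i = j)
    (hmem : ∀ i ≤ n, ∀ j < n, (v i ∈ K j ↔ i = j ∨ i = j + 1)) :
    IsInducedPath G v n := by
  have hadj : ∀ i < n, G.Adj (v i) (v (i + 1)) := by
    intro i hi
    refine (hK i hi).1 ((hmem i hi.le i hi).2 (Or.inl rfl))
      ((hmem (i + 1) hi i hi).2 (Or.inr rfl)) fun h => ?_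
    have := hinj _ hi.le _ hi h
    omega
  have hnadj : ∀ d, 2 ≤ d → ∀ i, i + d ≤ n → ¬ G.Adj (v i) (v (i + d)) := by
    intro d
    induction d using Nat.strong_induction_on with
    | _ d ih =>
    intro hd i hi hcontra
    have hadj0 := hadj i (by omega)
    have hadj1 := hadj (i + 1) (by omega)
    rcases (by omega : d = 2 ∨ d = 3 ∨ 4 ≤ d) with rfl | rfl | hd4
    · obtain ⟨w, hw, hw2⟩ := exists_mem_not_adj_of_notMem (hK i (by omega))
        (v := v (i + 2)) (by rw [hmem _ hi _ (by omega)]; omega)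
      obtain ⟨u, hu, hu0⟩ := exists_mem_not_adj_of_notMem (hK (i + 1) (by omega))
        (v := v i) (by rw [hmem _ (by omega) _ (by omega)]; omega)
      have h00 : v i ∈ K i := (hmem _ (by omega) _ (by omega)).2 (Or.inl rfl)
      have h10 : v (i + 1) ∈ K i := (hmem _ (by omega) _ (by omega)).2 (Or.inr rfl)
      have h11 : v (i + 1) ∈ K (i + 1) := (hmem _ (by omega) _ (by omega)).2 (Or.inl rfl)
      have h21 : v (i + 2) ∈ K (i + 1) := (hmem _ (by omega) _ (by omega)).2 (Or.inr rfl)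
      have hw0 : G.Adj w (v i) := (hK i (by omega)).1 hw h00 (by
        rintro rfl
        exact hw2 hcontra)
      have hw1 : G.Adj (v (i + 1)) w := (hK i (by omega)).1 h10 hw (by
        rintro rfl
        exact hw2 hadj1)
      have hu2 : G.Adj (v (i + 2)) u := (hK (i + 1) (by omega)).1 h21 hu (by
        rintro rfl
        exact hu0 hcontra.symm)
      have hu1 : G.Adj (v (i + 1)) u := (hK (i + 1) (by omega)).1 h11 hu (by
        rintro rfl
        exact hu0 hadj0.symm)
      have hwne : w ≠ v (i + 2) := by
        rintro rfl
        have := (hmem _ hi _ (by omega)).1 hw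
        omega
      have hune : v i ≠ u := by
        rintro rfl
        have := (hmem _ (by omega) _ (by omega)).1 hu
        omega
      by_cases hwu : G.Adj u w
      · exact hG.1.not_four_cycle hw0 hcontra hu2 hwu hwne hune hw2 fun h => hu0 h.symm
      · exact hG.2.not_gem hw0 hcontra hu2 hw2 (fun h => hu0 h.symm)
          (fun h => hwu h.symm) hw1 hu1
    · refine hG.1.not_four_cycle hadj0 hadj1 (hadj (i + 2) (by omega)) hcontra.symm
        ?_ ?_ (ih 2 (by omega) le_rfl i (by omega)) (ih 2 (by omega) le_rfl (i + 1) (by omega))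
      · intro h
        have := hinj _ (by omega) _ (by omega) h
        omega
      · intro h
        have := hinj _ (by omega) _ (by omega) h
        omega
    · obtain ⟨e, rfl⟩ : ∃ e, d = e + 1 := ⟨d - 1, by omega⟩
      have hpath : IsInducedPath G (fun j => v (i + j)) e := by
        have key : ∀ a b, a ≤ b → b ≤ e → G.Adj (v (i + a)) (v (i + b)) → b = a + 1 := by
          intro a b hab hb h
          have hne : a ≠ b := by
            rintro rfl
            exact h.ne rfl
          by_contra hb1
          refine ih (b - a) (by omega) (by omega) (i + a) (by omega) ?_
          rwa [show i + a + (b - a) = i + b by omega]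
        refine ⟨fun a ha b hb h => ?_, fun a ha b hb => ⟨fun h => ?_, ?_⟩⟩
        · have := hinj _ (by omega) _ (by omega) h
          omega
        · rcases le_total a b with hab | hab
          · exact Or.inl (key a b hab hb h)
          · exact Or.inr (key b a hab ha h.symm)
        · rintro (rfl | rfl)
          · exact hadj (i + a) (by omega)
          · exact (hadj (i + b) (by omega)).symm
      have := hG.2.le_length hpath
        (Walk.cons hcontra (Walk.cons (hadj (i + e) (by omega)).symm Walk.nil))
      simp only [Walk.length_cons, Walk.length_nil] at this
      omega
  have key : ∀ i j, i ≤ j → j ≤ n → G.Adj (v i) (v j) → j = i + 1 := by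
    intro i j hij hj h
    have hne : i ≠ j := by
      rintro rfl
      exact h.ne rfl
    by_contra hj1
    refine hnadj (j - i) (by omega) i (by omega) ?_
    rwa [show i + (j - i) = j by omega]
  refine ⟨hinj, fun i hi j hj => ⟨fun h => ?_, ?_⟩⟩
  · rcases le_total i j with hij | hij
    · exact Or.inl (key i j hij hj h)
    · exact Or.inr (key j i hij hi h.symm)
  · rintro (rfl | rfl)
    · exact hadj i (by omega)
    · exact (hadj j (by omega)).symm

section CliqueIncidence

variable {G : SimpleGraph V}

@[simp]
theorem cliqueIncidence_adj_inl_inr {v : V} {K : MaxCliques G} :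
    (cliqueIncidence G).Adj (Sum.inl v) (Sum.inr K) ↔ v ∈ K.val := by
  simp [cliqueIncidence]

@[simp]
theorem cliqueIncidence_adj_inr_inl {v : V} {K : MaxCliques G} :
    (cliqueIncidence G).Adj (Sum.inr K) (Sum.inl v) ↔ v ∈ K.val := by
  simp [cliqueIncidence]

@[simp]
theorem cliqueIncidence_not_adj_inl_inl {u v : V} :
    ¬ (cliqueIncidence G).Adj (Sum.inl u) (Sum.inl v) := by
  simp [cliqueIncidence]

@[simp]
theorem cliqueIncidence_not_adj_inr_inr {K L : MaxCliques G} :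
    ¬ (cliqueIncidence G).Adj (Sum.inr K) (Sum.inr L) := by
  simp [cliqueIncidence]

theorem cliqueIncidence_adj_isLeft {x y : V ⊕ MaxCliques G} (h : (cliqueIncidence G).Adj x y) :
    y.isLeft = !x.isLeft := by
  rcases x with x | x <;> rcases y with y | y <;> simp at h ⊢

theorem IsInducedPath.isLeft_two_mul {p : ℕ → V ⊕ MaxCliques G} {m : ℕ}
    (hp : IsInducedPath (cliqueIncidence G) p m) :
    ∀ i, 2 * i ≤ m → (p (2 * i)).isLeft = (p 0).isLeft := by
  intro i
  induction i with
  | zero => simp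
  | succ i ih =>
    intro hi
    have h1 := cliqueIncidence_adj_isLeft (hp.adj_succ (i := 2 * i) (by omega))
    have h2 := cliqueIncidence_adj_isLeft (hp.adj_succ (i := 2 * i + 1) (by omega))
    rw [show 2 * (i + 1) = 2 * i + 1 + 1 by ring, h2, h1, ih (by omega), Bool.not_not]

theorem IsInducedPath.isLeft_two_mul_add_one {p : ℕ → V ⊕ MaxCliques G} {m : ℕ}
    (hp : IsInducedPath (cliqueIncidence G) p m) (i : ℕ) (hi : 2 * i + 1 ≤ m) :
    (p (2 * i + 1)).isLeft = !(p 0).isLeft := by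
  rw [cliqueIncidence_adj_isLeft (hp.adj_succ (i := 2 * i) (by omega)),
    hp.isLeft_two_mul i (by omega)]

theorem Ptolemaic.exists_isInducedPath (hG : Ptolemaic G) {p : ℕ → V ⊕ MaxCliques G} {n : ℕ}
    (hp : IsInducedPath (cliqueIncidence G) p (2 * n)) (h0 : (p 0).isLeft) :
    ∃ v : ℕ → V, (∀ i ≤ n, p (2 * i) = Sum.inl (v i)) ∧ IsInducedPath G v n := by
  have hv : ∀ i, ∃ v : V, i ≤ n → p (2 * i) = Sum.inl v := by
    intro i
    by_cases hi : i ≤ n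
    · obtain ⟨v, hv⟩ := Sum.isLeft_iff.1
        ((hp.isLeft_two_mul i (by omega)).trans h0)
      exact ⟨v, fun _ => hv⟩
    · obtain ⟨v, -⟩ := Sum.isLeft_iff.1 h0
      exact ⟨v, fun h => absurd h hi⟩
  have hK : ∀ i, ∃ K : Set V, i < n → ∃ hK : K ∈ MaxCliques G,
      p (2 * i + 1) = Sum.inr ⟨K, hK⟩ := by
    intro i
    by_cases hi : i < n
    · have h := hp.isLeft_two_mul_add_one i (by omega)
      rw [h0, Bool.not_true, Sum.isLeft_eq_false, Sum.isRight_iff] at h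
      obtain ⟨K, hK⟩ := h
      exact ⟨K.1, fun _ => ⟨K.2, hK⟩⟩
    · exact ⟨∅, fun h => absurd h hi⟩
  choose v hv using hv
  choose K hK using hK
  refine ⟨v, hv, hG.isInducedPath_of_cliques (K := K) (fun i hi => (hK i hi).1) ?_ ?_⟩
  · intro i hi j hj h
    have := hp.1 (2 * i) (by omega) (2 * j) (by omega) (by rw [hv i hi, hv j hj, h])
    omega
  · intro i hi j hj
    obtain ⟨hKj, hj'⟩ := hK j hj
    have h := hp.2 (2 * i) (by omega) (2 * j + 1) (by omega)
    rw [hv i hi, hj', cliqueIncidence_adj_inl_inr] at h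
    rw [h]
    omega

theorem SimpleGraph.Walk.exists_walk_of_cliqueIncidence {x y : V ⊕ MaxCliques G}
    (w : (cliqueIncidence G).Walk x y) {b : V} (hy : y = Sum.inl b) :
    (∀ a, x = Sum.inl a → ∃ q : G.Walk a b, 2 * q.length ≤ w.length) ∧
      ∀ K : MaxCliques G, x = Sum.inr K → ∀ a ∈ K.1,
        ∃ q : G.Walk a b, 2 * q.length ≤ w.length + 1 := by
  induction w with
  | nil =>
    subst hy
    refine ⟨fun a ha => ?_, fun K hK => by simp at hK⟩
    obtain rfl := Sum.inl_injective ha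
    exact ⟨Walk.nil, by simp⟩
  | @cons x z y h w ih =>
    obtain ⟨ih1, ih2⟩ := ih hy
    refine ⟨?_, ?_⟩
    · rintro a rfl
      rcases z with z | K
      · simp at h
      · obtain ⟨q, hq⟩ := ih2 K rfl a (by simpa using h)
        exact ⟨q, by simpa using hq⟩
    · rintro K rfl a ha
      rcases z with c | L
      · obtain ⟨q, hq⟩ := ih1 c rfl
        by_cases hac : a = c
        · subst hac
          exact ⟨q, by rw [Walk.length_cons]; omega⟩
        · refine ⟨Walk.cons (K.2.1 ha (by simpa using h) hac) q, ?_⟩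
          simp only [Walk.length_cons]
          omega
      · simp at h

theorem Ptolemaic.le_length_of_isLeft_isLeft (hG : Ptolemaic G) {p : ℕ → V ⊕ MaxCliques G} {m : ℕ}
    (hp : IsInducedPath (cliqueIncidence G) p m) (h0 : (p 0).isLeft) (hm : (p m).isLeft)
    (w : (cliqueIncidence G).Walk (p 0) (p m)) : m ≤ w.length := by
  rcases Nat.even_or_odd' m with ⟨n, rfl | rfl⟩
  · obtain ⟨v, hv, hpath⟩ := hG.exists_isInducedPath hp h0
    obtain ⟨q, hq⟩ := (w.exists_walk_of_cliqueIncidence (hv n le_rfl)).1 (v 0)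
      (by simpa using hv 0 (Nat.zero_le n))
    have := hG.2.le_length hpath q
    omega
  · rw [hp.isLeft_two_mul_add_one n le_rfl, h0] at hm
    simp at hm

theorem Ptolemaic.exists_extension (hG : Ptolemaic G) {p : ℕ → V ⊕ MaxCliques G} {m : ℕ}
    (hp : IsInducedPath (cliqueIncidence G) p m) (hm : 2 ≤ m) (h0 : ¬ (p 0).isLeft) :
    ∃ q : ℕ → V ⊕ MaxCliques G, IsInducedPath (cliqueIncidence G) q (m + 1) ∧
      (q 0).isLeft ∧ ∀ i, q (i + 1) = p i := by
  have hright : ∀ i, 2 * i ≤ m → ∃ K, p (2 * i) = Sum.inr K := by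
    intro i hi
    rw [← Sum.isRight_iff, ← Sum.isLeft_eq_false, hp.isLeft_two_mul i hi]
    simpa using h0
  have hleft : ∀ i, 2 * i + 1 ≤ m → ∃ v, p (2 * i + 1) = Sum.inl v := by
    intro i hi
    rw [← Sum.isLeft_iff, hp.isLeft_two_mul_add_one i hi]
    simpa using h0
  obtain ⟨K, hK⟩ : ∃ K, p 0 = Sum.inr K := hright 0 (Nat.zero_le m)
  obtain ⟨L, hL⟩ : ∃ K, p 2 = Sum.inr K := hright 1 hm
  obtain ⟨w, hwK, hwL, hw3⟩ : ∃ w ∈ K.1, w ∉ L.1 ∧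
      (3 ≤ m → ∀ b, p 3 = Sum.inl b → ¬ G.Adj w b) := by
    by_cases hm3 : 3 ≤ m
    · obtain ⟨b, hb⟩ : ∃ v, p 3 = Sum.inl v := hleft 1 hm3
      have hbK : b ∉ K.1 := by
        have h := hp.2 3 hm3 0 (by omega)
        rw [hb, hK, cliqueIncidence_adj_inl_inr] at h
        rw [h]
        omega
      have hbL : b ∈ L.1 := by
        have h := hp.2 3 hm3 2 (by omega)
        rw [hb, hL, cliqueIncidence_adj_inl_inr] at h
        rw [h]
        omega
      obtain ⟨w, hw, hwb⟩ := exists_mem_not_adj_of_notMem K.2 hbK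
      refine ⟨w, hw, fun hwL => hwb (L.2.1 hwL hbL ?_), fun _ c hc => ?_⟩
      · rintro rfl
        exact hbK hw
      · rw [hb] at hc
        rwa [← Sum.inl_injective hc]
    · have hKL : ¬ K.1 ⊆ L.1 := by
        intro hsub
        have h := hp.1 0 (by omega) 2 hm
          (by rw [hK, hL, Subtype.ext (K.2.2 L.1 L.2.1 hsub)])
        omega
      obtain ⟨w, hw, hw'⟩ := Set.not_subset.1 hKL
      exact ⟨w, hw, hw', fun h => absurd h hm3⟩
  have hne : ∀ i ≤ m, p i ≠ Sum.inl w := by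
    intro i hi h
    have h1 := (hp.2 i hi 0 (by omega)).1 (by rw [h, hK]; simpa using hwK)
    have h2 := (hp.2 i hi 2 hm).2 (by omega)
    rw [h, hL] at h2
    exact hwL (by simpa using h2)
  have hadj : ∀ i ≤ m, (cliqueIncidence G).Adj (Sum.inl w) (p i) → i = 0 := by
    intro i hi h
    rcases Nat.even_or_odd' i with ⟨k, rfl | rfl⟩
    · obtain ⟨M, hM⟩ := hright k hi
      rw [hM, cliqueIncidence_adj_inl_inr] at h
      rcases (by omega : k = 0 ∨ k = 1 ∨ 2 ≤ k) with rfl | rfl | hk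
      · rfl
      · rw [show 2 * 1 = 2 from rfl, hL] at hM
        rw [← Sum.inr_injective hM] at h
        exact absurd h hwL
      · exfalso
        obtain ⟨v, hv, hpath⟩ := hG.exists_isInducedPath (n := k - 1)
          (hp.shift (k := 1) (m := 2 * (k - 1)) (by omega))
          (by rw [Sum.isLeft_iff]; exact hleft 0 (by omega))
        have hv0 : p 1 = Sum.inl (v 0) := hv 0 (by omega)
        have hv1 : p 3 = Sum.inl (v 1) := hv 1 (by omega)
        have hvk : p (2 * k - 1) = Sum.inl (v (k - 1)) := by
          rw [← hv (k - 1) le_rfl]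
          congr 1
          omega
        have hw1 : ¬ G.Adj w (v 1) := hw3 (by omega) _ hv1
        have hv0K : v 0 ∈ K.1 := by
          have h := (hp.2 1 (by omega) 0 (by omega)).2 (by omega)
          rw [hv0, hK] at h
          simpa using h
        have hvkM : v (k - 1) ∈ M.1 := by
          have h := (hp.2 (2 * k - 1) (by omega) (2 * k) hi).2 (by omega)
          rw [hvk, hM] at h
          simpa using h
        have hwv0 : G.Adj w (v 0) := K.2.1 hwK hv0K (by
          rintro rfl
          exact hne 1 (by omega) hv0)
        have hwvk : G.Adj (v (k - 1)) w := M.2.1 hvkM h (by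
          intro h
          exact hne (2 * k - 1) (by omega) (hvk.trans (congrArg _ h)))
        have hlen := hG.2.le_length hpath (Walk.cons hwv0.symm (Walk.cons hwvk.symm Walk.nil))
        simp only [Walk.length_cons, Walk.length_nil] at hlen
        rcases (by omega : k = 2 ∨ k = 3) with rfl | rfl
        · exact hw1 hwvk.symm
        · refine hG.1.not_four_cycle (hpath.adj_succ (i := 0) (by omega))
            (hpath.adj_succ (i := 1) (by omega)) hwvk hwv0 (fun h => ?_) (fun h => ?_)
            (fun h => ?_) (fun h => hw1 h.symm)
          · have := hpath.1 _ (by omega) _ (by omega) h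
            omega
          · exact hne 3 (by omega) (hv1.trans (congrArg _ h))
          · have := (hpath.2 _ (by omega) _ (by omega)).1 h
            omega
    · obtain ⟨b, hb⟩ := hleft k hi
      rw [hb] at h
      simp at h
  have hadj0 : (cliqueIncidence G).Adj (Sum.inl w) (p 0) := by
    rw [hK]
    simpa using hwK
  let q : ℕ → V ⊕ MaxCliques G := fun i => match i with
    | 0 => Sum.inl w
    | i + 1 => p i
  refine ⟨q, ⟨?_, ?_⟩, rfl, fun i => rfl⟩
  · intro i hi j hj hij
    rcases i with _ | i <;> rcases j with _ | j
    · rfl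
    · exact absurd hij.symm (hne j (by omega))
    · exact absurd hij (hne i (by omega))
    · rw [hp.1 i (by omega) j (by omega) hij]
  · intro i hi j hj
    rcases i with _ | i <;> rcases j with _ | j
    · simp
    · refine ⟨fun h => ?_, fun h => ?_⟩
      · have := hadj j (by omega) h
        omega
      · obtain rfl : j = 0 := by omega
        exact hadj0
    · refine ⟨fun h => ?_, fun h => ?_⟩
      · have := hadj i (by omega) h.symm
        omega
      · obtain rfl : i = 0 := by omega
        exact hadj0.symm
    · have h := hp.2 i (by omega) j (by omega)
      change (cliqueIncidence G).Adj (p i) (p j) ↔ _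
      rw [h]
      omega

theorem IsInducedPath.le_length_of_le_one {H : SimpleGraph V} {p : ℕ → V} {m : ℕ}
    (hp : IsInducedPath H p m) (hm : m ≤ 1) (w : H.Walk (p 0) (p m)) : m ≤ w.length := by
  by_contra! h
  have := hp.1 0 (by omega) m le_rfl (w.eq_of_length_eq_zero (by omega))
  omega

theorem Ptolemaic.le_length_of_isLeft (hG : Ptolemaic G) {p : ℕ → V ⊕ MaxCliques G} {m : ℕ}
    (hp : IsInducedPath (cliqueIncidence G) p m) (hm : (p m).isLeft)
    (w : (cliqueIncidence G).Walk (p 0) (p m)) : m ≤ w.length := by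
  by_cases h0 : (p 0).isLeft
  · exact hG.le_length_of_isLeft_isLeft hp h0 hm w
  by_cases hm2 : 2 ≤ m
  · obtain ⟨q, hq, hq0, hqp⟩ := hG.exists_extension hp hm2 h0
    have hadj : (cliqueIncidence G).Adj (q 0) (p 0) := by
      rw [← hqp]
      exact hq.adj_succ (by omega)
    have := hG.le_length_of_isLeft_isLeft hq hq0 (by rwa [hqp])
      ((Walk.cons hadj w).copy rfl (hqp m).symm)
    simpa using this
  · exact hp.le_length_of_le_one (by omega) w

theorem Ptolemaic.le_length (hG : Ptolemaic G) {p : ℕ → V ⊕ MaxCliques G} {m : ℕ}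
    (hp : IsInducedPath (cliqueIncidence G) p m)
    (w : (cliqueIncidence G).Walk (p 0) (p m)) : m ≤ w.length := by
  by_cases hm : (p m).isLeft
  · exact hG.le_length_of_isLeft hp hm w
  by_cases hm2 : 2 ≤ m
  · obtain ⟨q, hq, hq0, hqp⟩ := hG.exists_extension hp.reverse hm2 (by simpa using hm)
    have hend : q (m + 1) = p 0 := by rw [hqp, Nat.sub_self]
    have hadj : (cliqueIncidence G).Adj (p m) (q 0) := by
      have h := hq.adj_succ (i := 0) (by omega)
      rw [hqp] at h
      exact h.symm
    have := hG.le_length_of_isLeft hq.reverse (by simpa using hq0)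
      ((w.concat hadj).copy hend.symm (by simp))
    simpa using this
  · exact hp.le_length_of_le_one (by omega) w

end CliqueIncidence

/-- The vertex-clique incidence bipartite graph of a Ptolemaic
graph is bipartite distance hereditary. -/
theorem cliqueIncidence_BDH [Fintype V] (G : SimpleGraph V)
    (hG : Ptolemaic G) :
    IsBipartition (cliqueIncidence G) (Set.range Sum.inl) (Set.range Sum.inr) ∧
      DistHereditary (cliqueIncidence G) := by
  refine ⟨⟨?_, ?_, ?_⟩, distHereditary_of_le_length fun p n hp w => hG.le_length hp w⟩
  · exact Set.isCompl_range_inl_range_inr.disjoint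
  · exact Set.range_inl_union_range_inr
  · rintro (u | u) (v | v) h <;> simp at h ⊢
end

section
/- A connected bipartite graph G is distance hereditary if and only if G contains neither a hole (an induced cycle on at least six vertices) nor an induced subgraph isomorphic to the domino. -/
open SimpleGraph

variable {V : Type*}

theorem cycleGraph'_adj_natCast {n i j : ℕ} (hn : 2 ≤ n) (hi : i < n) (hj : j < n) :
    (cycleGraph' n).Adj (i : ZMod n) (j : ZMod n) ↔
      j = i + 1 ∨ i = j + 1 ∨ (i = 0 ∧ j + 1 = n) ∨ (j = 0 ∧ i + 1 = n) := by
  have key : ∀ {a b : ℕ}, a < n → b < n →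
      ((b : ZMod n) = (a : ZMod n) + 1 ↔ b = a + 1 ∨ (b = 0 ∧ a + 1 = n)) := by
    intro a b ha hb
    rw [← Nat.cast_add_one, ZMod.natCast_eq_natCast_iff', Nat.mod_eq_of_lt hb]
    rcases Nat.lt_or_ge (a + 1) n with h | h
    · rw [Nat.mod_eq_of_lt h]; omega
    · obtain rfl : n = a + 1 := by omega
      rw [Nat.mod_self]; omega
  have hne : (i : ZMod n) = (j : ZMod n) ↔ i = j := by
    rw [ZMod.natCast_eq_natCast_iff', Nat.mod_eq_of_lt hi, Nat.mod_eq_of_lt hj]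
  rw [cycleGraph', SimpleGraph.fromRel_adj, key hi hj, key hj hi, Ne, hne]
  omega

/-- Induced cycles, indexed by natural numbers below `n`. -/
theorem hasInducedCycle_iff {G : SimpleGraph V} {n : ℕ} (hn : 2 ≤ n) :
    HasInducedCycle G n ↔ ∃ g : ℕ → V, (∀ i < n, ∀ j < n, g i = g j → i = j) ∧
      ∀ i < n, ∀ j < n, (G.Adj (g i) (g j) ↔
        j = i + 1 ∨ i = j + 1 ∨ (i = 0 ∧ j + 1 = n) ∨ (j = 0 ∧ i + 1 = n)) := by
  have : NeZero n := ⟨by omega⟩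
  constructor
  · rintro ⟨f, hinj, hadj⟩
    refine ⟨fun i => f i, fun i hi j hj h => ?_, fun i hi j hj => ?_⟩
    · have := congrArg ZMod.val (hinj h)
      rwa [ZMod.val_cast_of_lt hi, ZMod.val_cast_of_lt hj] at this
    · rw [← hadj, cycleGraph'_adj_natCast hn hi hj]
  · rintro ⟨g, hinj, hadj⟩
    refine ⟨fun z => g z.val, fun x y h => ?_, fun x y => ?_⟩
    · exact ZMod.val_injective n (hinj _ x.val_lt _ y.val_lt h)
    · rw [hadj _ x.val_lt _ y.val_lt, ← cycleGraph'_adj_natCast hn x.val_lt y.val_lt,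
        ZMod.natCast_zmod_val, ZMod.natCast_zmod_val]

theorem exists_walk_of_forall_adj {G : SimpleGraph V} {p : ℕ → V} {n : ℕ}
    (hp : ∀ i < n, G.Adj (p i) (p (i + 1))) {i j : ℕ} (hij : i ≤ j) (hj : j ≤ n) :
    ∃ w : G.Walk (p i) (p j), w.length = j - i := by
  induction j, hij using Nat.le_induction with
  | base => exact ⟨.nil, by simp⟩
  | succ j hij ih =>
    obtain ⟨w, hw⟩ := ih (by omega)
    exact ⟨w.concat (hp j (by omega)), by rw [Walk.length_concat]; omega⟩

/-- A shortest path, given as a sequence of vertices. -/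
theorem exists_geodesic {G : SimpleGraph V} {u v : V} (h : G.Reachable u v) :
    ∃ p : ℕ → V, p 0 = u ∧ p (G.dist u v) = v ∧
      ∀ i j, i ≤ j → j ≤ G.dist u v →
        G.Reachable (p i) (p j) ∧ G.dist (p i) (p j) = j - i := by
  obtain ⟨w, hw⟩ := h.exists_walk_length_eq_dist
  have hadj : ∀ i < w.length, G.Adj (w.getVert i) (w.getVert (i + 1)) :=
    fun i hi => w.adj_getVert_succ hi
  have h0 : w.getVert 0 = u := w.getVert_zero
  have hl : w.getVert w.length = v := w.getVert_length
  rw [← hw]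
  refine ⟨w.getVert, h0, hl, fun i j hij hj => ?_⟩
  obtain ⟨a, ha⟩ := exists_walk_of_forall_adj hadj (Nat.zero_le i) (hij.trans hj)
  obtain ⟨b, hb⟩ := exists_walk_of_forall_adj hadj hij hj
  obtain ⟨c, hc⟩ := exists_walk_of_forall_adj hadj hj le_rfl
  obtain ⟨d, hd⟩ := b.reachable.exists_walk_length_eq_dist
  have h1 := dist_le b
  have h2 := dist_le ((a.append d).append c)
  rw [Walk.length_append, Walk.length_append] at h2
  simp only [h0, hl] at h2
  exact ⟨b.reachable, by omega⟩

/-- In a distance hereditary graph, if the ends of a path have a common neighbour, then they are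
equal or adjacent or have a common neighbour on the path. -/
theorem DistHereditary.exists_common_neighbor {G : SimpleGraph V} (h : DistHereditary G)
    {p : ℕ → V} {n : ℕ} (hp : ∀ i < n, G.Adj (p i) (p (i + 1))) {w : V}
    (hw : G.Adj w (p 0)) (hw' : G.Adj w (p n)) :
    p 0 = p n ∨ G.Adj (p 0) (p n) ∨ ∃ i ≤ n, G.Adj (p 0) (p i) ∧ G.Adj (p i) (p n) := by
  let S : Set V := {x | ∃ i ≤ n, p i = x}
  let q : ℕ → S := fun i => ⟨p (min i n), min i n, min_le_right _ _, rfl⟩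
  have hq : ∀ i < n, (G.induce S).Adj (q i) (q (i + 1)) := fun i hi => by
    have := hp i hi
    simpa [q, min_eq_left hi.le, min_eq_left (Nat.succ_le_of_lt hi)] using this
  obtain ⟨c, -⟩ := exists_walk_of_forall_adj hq (Nat.zero_le n) le_rfl
  have hd := h S _ _ c.reachable
  have hle := dist_le (Walk.cons hw.symm (Walk.cons hw' Walk.nil))
  have e0 : (q 0 : V) = p 0 := by simp [q]
  have en : (q n : V) = p n := by simp [q]
  rw [e0, en] at hd
  simp only [Walk.length_cons, Walk.length_nil] at hle
  obtain ⟨d, hd'⟩ := c.reachable.exists_walk_length_eq_dist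
  rw [← e0, ← en]
  generalize q 0 = s, q n = t at *
  cases d with
  | nil => left; rfl
  | @cons _ x _ h1 d =>
    cases d with
    | nil => right; left; exact h1
    | @cons _ y _ h2 d =>
      cases d with
      | nil =>
        right; right
        obtain ⟨i, hi, hx⟩ := x.2
        refine ⟨i, hi, ?_⟩
        rw [hx]
        exact ⟨h1, h2⟩
      | cons h3 d => simp only [Walk.length_cons] at hd'; omega

theorem DistHereditary.not_hasInducedCycle {G : SimpleGraph V} (h : DistHereditary G)
    {n : ℕ} (hn : 6 ≤ n) : ¬ HasInducedCycle G n := by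
  rw [hasInducedCycle_iff (by omega)]
  rintro ⟨g, hinj, hadj⟩
  have := h.exists_common_neighbor (p := fun i => g (i + 1)) (n := n - 2) (w := g 0)
    (fun i hi => (hadj _ (by omega) _ (by omega)).2 (by omega))
    ((hadj _ (by omega) _ (by omega)).2 (by omega))
    ((hadj _ (by omega) _ (by omega)).2 (by omega))
  rcases this with h1 | h1 | ⟨i, hi, h1, h2⟩
  · have := hinj _ (by omega) _ (by omega) h1
    omega
  · rw [hadj _ (by omega) _ (by omega)] at h1
    omega
  · rw [hadj _ (by omega) _ (by omega)] at h1 h2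
    omega

instance : DecidableRel domino.Adj := fun i j =>
  decidable_of_iff (i ≠ j ∧ ((j = i + 1 ∨ (i = 0 ∧ j = 3)) ∨ (i = j + 1 ∨ (j = 0 ∧ i = 3))))
    (SimpleGraph.fromRel_adj (fun i j : Fin 6 => j = i + 1 ∨ (i = 0 ∧ j = 3)) i j).symm

theorem DistHereditary.dominoFree {G : SimpleGraph V} (h : DistHereditary G) :
    DominoFree G := by
  rintro ⟨f, hinj, hadj⟩
  have := h.exists_common_neighbor (p := fun i => f (Fin.ofNat 6 (i + 1))) (n := 4) (w := f 0)
    (fun i hi => (hadj _ _).1 (by interval_cases i <;> decide))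
    ((hadj _ _).1 (by decide)) ((hadj _ _).1 (by decide))
  rcases this with h1 | h1 | ⟨i, hi, h1, h2⟩
  · exact absurd (hinj h1) (by decide)
  · exact absurd ((hadj _ _).2 h1) (by decide)
  · have h3 := (hadj _ _).2 h1
    have h4 := (hadj _ _).2 h2
    clear h1 h2
    interval_cases i <;> revert h3 h4 <;> decide

/-- Two disjoint induced paths `a` and `b` on vertices `0, …, m`, where `a i` and `b j` are adjacent
only if `i = j`. -/
structure IsLadder (G : SimpleGraph V) (a b : ℕ → V) (m : ℕ) : Prop where
  left_inj : ∀ i ≤ m, ∀ j ≤ m, a i = a j → i = j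
  right_inj : ∀ i ≤ m, ∀ j ≤ m, b i = b j → i = j
  left_ne_right : ∀ i ≤ m, ∀ j ≤ m, a i ≠ b j
  left_adj : ∀ i ≤ m, ∀ j ≤ m, (G.Adj (a i) (a j) ↔ j = i + 1 ∨ i = j + 1)
  right_adj : ∀ i ≤ m, ∀ j ≤ m, (G.Adj (b i) (b j) ↔ j = i + 1 ∨ i = j + 1)
  eq_of_adj : ∀ i ≤ m, ∀ j ≤ m, G.Adj (a i) (b j) → i = j

namespace IsLadder

variable {G : SimpleGraph V} {a b : ℕ → V} {m : ℕ}

theorem shift (h : IsLadder G a b m) {s l : ℕ} (hs : s + l ≤ m) :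
    IsLadder G (fun i => a (s + i)) (fun i => b (s + i)) l where
  left_inj i hi j hj e := by have := h.left_inj _ (by omega) _ (by omega) e; omega
  right_inj i hi j hj e := by have := h.right_inj _ (by omega) _ (by omega) e; omega
  left_ne_right i hi j hj := h.left_ne_right _ (by omega) _ (by omega)
  left_adj i hi j hj := by rw [h.left_adj _ (by omega) _ (by omega)]; omega
  right_adj i hi j hj := by rw [h.right_adj _ (by omega) _ (by omega)]; omega
  eq_of_adj i hi j hj e := by have := h.eq_of_adj _ (by omega) _ (by omega) e; omega

theorem hasInducedCycle (h : IsLadder G a b m) (h0 : G.Adj (a 0) (b 0))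
    (hm : G.Adj (a m) (b m)) (hmid : ∀ i, 0 < i → i < m → ¬ G.Adj (a i) (b i)) :
    HasInducedCycle G (2 * m + 2) := by
  rw [hasInducedCycle_iff (by omega)]
  have hab : ∀ i ≤ m, ∀ j ≤ m, (G.Adj (a i) (b j) ↔ i = j ∧ (i = 0 ∨ i = m)) := by
    intro i hi j hj
    constructor
    · intro e
      obtain rfl := h.eq_of_adj i hi j hj e
      refine ⟨rfl, ?_⟩
      by_contra hne
      exact hmid i (by omega) (by omega) e
    · rintro ⟨rfl, rfl | rfl⟩ <;> assumption
  refine ⟨fun i => if i ≤ m then a i else b (2 * m + 1 - i), fun i hi j hj e => ?_,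
    fun i hi j hj => ?_⟩
  · dsimp only at e
    split_ifs at e with hi' hj' hj'
    · exact h.left_inj _ hi' _ hj' e
    · exact absurd e (h.left_ne_right _ hi' _ (by omega))
    · exact absurd e.symm (h.left_ne_right _ hj' _ (by omega))
    · have := h.right_inj _ (by omega) _ (by omega) e
      omega
  · dsimp only
    split_ifs with hi' hj' hj'
    · rw [h.left_adj _ hi' _ hj']; omega
    · rw [hab _ hi' _ (by omega)]; omega
    · rw [G.adj_comm, hab _ hj' _ (by omega)]; omega
    · rw [h.right_adj _ (by omega) _ (by omega)]; omega

theorem not_dominoFree (h : IsLadder G a b 2) (h0 : G.Adj (a 0) (b 0))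
    (h1 : G.Adj (a 1) (b 1)) (h2 : G.Adj (a 2) (b 2)) : ¬ DominoFree G := by
  have hab : ∀ i ≤ 2, ∀ j ≤ 2, (G.Adj (a i) (b j) ↔ i = j) := by
    refine fun i hi j hj => ⟨h.eq_of_adj i hi j hj, ?_⟩
    rintro rfl
    interval_cases i <;> assumption
  have hba : ∀ i ≤ 2, ∀ j ≤ 2, (G.Adj (b i) (a j) ↔ j = i) := fun i hi j hj => by
    rw [G.adj_comm, hab j hj i hi]
  have hadj : ∀ i j, domino.Adj i j ↔
      G.Adj (![a 1, a 0, b 0, b 1, b 2, a 2] i) (![a 1, a 0, b 0, b 1, b 2, a 2] j) := by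
    have hl := h.left_adj
    have hr := h.right_adj
    intro i j
    fin_cases i <;> fin_cases j <;> simp [hl, hr, hab, hba, -SimpleGraph.irrefl] <;> decide
  have htwin : ∀ i j, (∀ k, domino.Adj i k ↔ domino.Adj j k) → i = j := by decide
  exact fun hd => hd ⟨_, fun i j e => htwin i j fun k => by rw [hadj, hadj, e], hadj⟩

/-- A ladder whose first and last rungs are present contains a hole or a domino. -/
theorem exists_hole_or_domino (h : IsLadder G a b m) (hm2 : 2 ≤ m) (h0 : G.Adj (a 0) (b 0))
    (hm : G.Adj (a m) (b m)) : (∃ n, 6 ≤ n ∧ HasInducedCycle G n) ∨ ¬ DominoFree G := by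
  by_contra! hcon
  obtain ⟨hhole, hdom⟩ := hcon
  have next : ∀ s < m, G.Adj (a s) (b s) → G.Adj (a (s + 1)) (b (s + 1)) := by
    intro s hs hsa
    by_contra hne
    classical
    have hex : ∃ l, 0 < l ∧ s + l ≤ m ∧ G.Adj (a (s + l)) (b (s + l)) :=
      ⟨m - s, by omega, by omega, by rwa [Nat.add_sub_cancel' hs.le]⟩
    obtain ⟨hl0, hlm, hl⟩ := Nat.find_spec hex
    have hmin := fun i (hi : i < Nat.find hex) => Nat.find_min hex hi
    set l := Nat.find hex
    have hl1 : l ≠ 1 := fun e => hne (by rwa [e] at hl)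
    refine hhole (2 * l + 2) (by omega)
      ((h.shift hlm).hasInducedCycle hsa hl fun i hi hil e => ?_)
    exact hmin i hil ⟨hi, by omega, e⟩
  have h1 := next 0 (by omega) h0
  have h2 := next 1 (by omega) h1
  have h' := h.shift (s := 0) (l := 2) (by omega)
  simp only [Nat.zero_add] at h'
  exact h'.not_dominoFree h0 h1 h2 hdom

end IsLadder

/-- A geodesic `q` of length `m` and a path `p` of length `m + 2` with the same ends, all of whose
proper subpaths are geodesics, form a ladder. -/
theorem isLadder_of_geodesics {G : SimpleGraph V} (hconn : G.Connected) {p q : ℕ → V} {m : ℕ}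
    (hp : ∀ i j, i ≤ j → j ≤ m + 2 → j - i < m + 2 → G.dist (p i) (p j) = j - i)
    (hq : ∀ i j, i ≤ j → j ≤ m → G.dist (q i) (q j) = j - i)
    (h0 : q 0 = p 0) (hm : q m = p (m + 2)) : IsLadder G (fun i => p (i + 1)) q m := by
  have adj : ∀ {x : ℕ → V} {i j : ℕ}, G.dist (x (min i j)) (x (max i j)) = max i j - min i j →
      (x i = x j → i = j) ∧ (G.Adj (x i) (x j) ↔ j = i + 1 ∨ i = j + 1) := by
    intro x i j hx
    rw [← dist_eq_one_iff_adj, ← hconn.dist_eq_zero_iff]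
    rcases le_total i j with h | h
    · rw [min_eq_left h, max_eq_right h] at hx
      omega
    · rw [min_eq_right h, max_eq_left h, SimpleGraph.dist_comm] at hx
      omega
  have cross : ∀ i ≤ m, ∀ j ≤ m, G.dist (p (i + 1)) (q j) ≠ 0 ∧
      (G.dist (p (i + 1)) (q j) = 1 → i = j) := by
    intro i hi j hj
    have e1 := hp 0 (i + 1) (by omega) (by omega) (by omega)
    have e2 := hp (i + 1) (m + 2) (by omega) (by omega) (by omega)
    have e3 := hq 0 j (by omega) hj
    have e4 := hq j m hj le_rfl
    have t1 := hconn.dist_triangle (u := p 0) (v := q j) (w := p (i + 1))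
    have t2 := hconn.dist_triangle (u := p (i + 1)) (v := q j) (w := p (m + 2))
    rw [h0] at e3
    rw [hm] at e4
    rw [SimpleGraph.dist_comm (u := q j) (v := p (i + 1))] at t1
    omega
  refine ⟨fun i hi j hj e => ?_, fun i hi j hj => ?_, fun i hi j hj e => ?_,
    fun i hi j hj => ?_, fun i hi j hj => ?_, fun i hi j hj e => ?_⟩
  · have := (adj (hp (min (i + 1) (j + 1)) (max (i + 1) (j + 1))
      (by omega) (by omega) (by omega))).1 e
    omega
  · exact (adj (hq _ _ (by omega) (by omega))).1
  · exact (cross i hi j hj).1 (hconn.dist_eq_zero_iff.2 e)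
  · rw [(adj (hp (min (i + 1) (j + 1)) (max (i + 1) (j + 1))
      (by omega) (by omega) (by omega))).2]
    omega
  · exact (adj (hq _ _ (by omega) (by omega))).2
  · exact (cross i hi j hj).2 (dist_eq_one_iff_adj.2 e)

theorem IsBipartition.even_length_iff {G : SimpleGraph V} {X Y : Set V}
    (h : IsBipartition G X Y) {u v : V} (w : G.Walk u v) :
    Even w.length ↔ (u ∈ X ↔ v ∈ X) := by
  induction w with
  | nil => simp
  | @cons u v x e w ih =>
    have hd := Set.disjoint_left.1 h.1
    have huv : u ∈ X ↔ v ∉ X := by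
      rcases h.2.2 e with ⟨h1, h2⟩ | ⟨h1, h2⟩
      · exact iff_of_true h1 fun h3 => hd h3 h2
      · exact iff_of_false (fun h3 => hd h3 h1) (not_not.2 h2)
    rw [Walk.length_cons, Nat.even_add_one, ih, huv]
    tauto

theorem distHereditary_of_hole_domino_free {G : SimpleGraph V} (hconn : G.Connected)
    {X Y : Set V} (hbip : IsBipartition G X Y) (hhole : ∀ n, 6 ≤ n → ¬ HasInducedCycle G n)
    (hdom : DominoFree G) : DistHereditary G := by
  intro S u v huv
  induction hk : (G.induce S).dist u v using Nat.strong_induction_on generalizing u v with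
  | _ k ih =>
  subst hk
  obtain ⟨p, hp0, hpk, hp⟩ := exists_geodesic huv
  generalize hk : (G.induce S).dist u v = k at *
  have hlt : ∀ i j, i ≤ j → j ≤ k → j - i < k → G.dist (p i : V) (p j) = j - i := by
    intro i j hij hj hlt
    exact (ih _ hlt _ _ (hp i j hij hj).1 (hp i j hij hj).2).symm
  obtain ⟨w, hw⟩ := huv.exists_walk_length_eq_dist
  obtain ⟨w', hw'⟩ := hconn.exists_walk_length_eq_dist (u : V) v
  have hle : G.dist (u : V) v ≤ k := by
    have := dist_le (w.map (Embedding.induce S).toHom)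
    rw [Walk.length_map, hw, hk] at this
    exact this
  have hpar : Even k ↔ Even (G.dist (u : V) v) := by
    rw [← hw', hbip.even_length_iff, ← hk, ← hw,
      ← Walk.length_map (Embedding.induce S).toHom, hbip.even_length_iff]
    rfl
  by_contra hne
  have hk0 : G.dist (u : V) v ≠ 0 := fun e => by
    have : u = v := Subtype.ext (hconn.dist_eq_zero_iff.1 e)
    subst this
    rw [dist_self] at hk
    omega
  have hk1 : G.dist (u : V) v ≠ 1 := fun e => by
    have : G.Adj (u : V) v := dist_eq_one_iff_adj.1 e
    have : (G.induce S).Adj u v := this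
    rw [dist_eq_one_iff_adj.2 this] at hk
    omega
  have htri := hconn.dist_triangle (u := (u : V)) (v := (v : V)) (w := p (k - 1))
  have e1 := hlt 0 (k - 1) (by omega) (by omega) (by omega)
  have e2 := hlt (k - 1) k (by omega) (by omega) (by omega)
  rw [hp0] at e1
  rw [hpk] at e2
  rw [SimpleGraph.dist_comm (u := (v : V))] at htri
  obtain ⟨q, hq0, hqm, hq⟩ := exists_geodesic (hconn (u : V) v)
  generalize G.dist (u : V) v = m at *
  obtain rfl : k = m + 2 := by
    rw [Nat.even_iff, Nat.even_iff] at hpar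
    omega
  have hlad := isLadder_of_geodesics hconn (p := fun i => (p i : V)) hlt
    (fun i j hij hj => (hq i j hij hj).2) (by simp only [hq0, hp0]) (by simp only [hqm, hpk])
  rcases hlad.exists_hole_or_domino (by omega)
    (by
      rw [hq0, ← hp0, G.adj_comm]
      exact dist_eq_one_iff_adj.1 (hlt 0 1 (by omega) (by omega) (by omega)))
    (by
      rw [hqm, ← hpk]
      have := hlt (m + 1) (m + 2) (by omega) (by omega) (by omega)
      exact dist_eq_one_iff_adj.1 (by omega)) with ⟨n, hn, hc⟩ | hd
  · exact hhole n hn hc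
  · exact hd hdom

/-- A connected bipartite graph is distance hereditary iff it
contains no hole (induced cycle on at least six vertices) and no induced
domino. -/
theorem BDH_iff_hole_domino_free [Fintype V] (G : SimpleGraph V)
    (hconn : G.Connected) (hbip : ∃ X Y : Set V, IsBipartition G X Y) :
    DistHereditary G ↔
      ((∀ n, 6 ≤ n → ¬ HasInducedCycle G n) ∧ DominoFree G) := by
  obtain ⟨X, Y, hXY⟩ := hbip
  exact ⟨fun h => ⟨fun _ hn => h.not_hasInducedCycle hn, h.dominoFree⟩,
    fun h => distHereditary_of_hole_domino_free hconn hXY h.1 h.2⟩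
end

section
/- Let G be a connected bipartite distance hereditary graph with color classes X and Y and at least one edge. Then there exists a partial order ≤ on X such that for every x ∈ X the set {x' ∈ X : x' ≤ x} is a chain, and for every y ∈ Y there exist a, b ∈ X with a ≤ b and N(y) = {x ∈ X : a ≤ x ≤ b}; that is, G is a path-arborescence bipartite graph: X can be identified with the arc set of an arborescence so that the neighborhood of each vertex of Y is the arc set of a directed path. -/
open SimpleGraph

variable {V : Type*}

/-- The vertices of every walk of `H` support a geodesic of `H` between its endpoints. -/
def GeodesicsInWalks {W : Type*} (H : SimpleGraph W) : Prop :=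
  ∀ ⦃a b : W⦄ (p : H.Walk a b), ∃ q : H.Walk a b,
    q.support ⊆ p.support ∧ q.length = H.dist a b

theorem SimpleGraph.Walk.length_induce {G : SimpleGraph V} {s : Set V} {a b : V}
    (p : G.Walk a b) (hp : ∀ v ∈ p.support, v ∈ s) : (p.induce s hp).length = p.length := by
  conv_rhs => rw [← Walk.map_induce p hp]
  exact (Walk.length_map _ _).symm

theorem DistHereditary.geodesicsInWalks {G : SimpleGraph V} (hG : DistHereditary G) :
    GeodesicsInWalks G := by
  intro a b p
  let S : Set V := {v | v ∈ p.support}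
  have hr : (G.induce S).Reachable ⟨a, p.start_mem_support⟩ ⟨b, p.end_mem_support⟩ :=
    ⟨p.induce S fun _ h => h⟩
  obtain ⟨q, hq⟩ := hr.exists_walk_length_eq_dist
  let q' : G.Walk a b := q.map (Embedding.induce (G := G) S).toHom
  refine ⟨q', ?_, ?_⟩
  · intro v hv
    have hv' : v ∈ (q.map (Embedding.induce (G := G) S).toHom).support := hv
    rw [Walk.support_map, List.mem_map] at hv'
    obtain ⟨w, -, rfl⟩ := hv'
    exact w.2
  · have h : q'.length = q.length := Walk.length_map _ _
    rw [h, hq, hG S _ _ hr]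

theorem DistHereditary.geodesicsInWalks_induce {G : SimpleGraph V} (hG : DistHereditary G)
    (T : Set V) : GeodesicsInWalks (G.induce T) := by
  intro a b p
  let p' : G.Walk (a : V) (b : V) := p.map (Embedding.induce (G := G) T).toHom
  have hp' : ∀ v ∈ p'.support, ∃ w ∈ p.support, (w : V) = v := by
    intro v hv
    have hv' : v ∈ (p.map (Embedding.induce (G := G) T).toHom).support := hv
    rwa [Walk.support_map, List.mem_map] at hv'
  obtain ⟨q, hqs, hq⟩ := hG.geodesicsInWalks p'
  have hqT : ∀ v ∈ q.support, v ∈ T := by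
    intro v hv
    obtain ⟨w, -, rfl⟩ := hp' v (hqs hv)
    exact w.2
  refine ⟨q.induce T hqT, ?_, ?_⟩
  · intro w hw
    rw [Walk.support_induce, List.mem_attachWith] at hw
    obtain ⟨w', hw', h⟩ := hp' _ (hqs hw)
    rwa [← Subtype.ext h]
  · exact (q.length_induce hqT).trans (hq.trans (hG T a b ⟨p⟩).symm)

section Pruning

variable {W : Type*} {H : SimpleGraph W}

theorem SimpleGraph.Coloring.dist_eq_add_one_or_of_adj (c : H.Coloring Bool) {u a b : W}
    (ha : H.Reachable u a) (hab : H.Adj a b) :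
    H.dist u b = H.dist u a + 1 ∨ H.dist u a = H.dist u b + 1 := by
  have hb : H.Reachable u b := ha.trans hab.reachable
  obtain ⟨p, hp⟩ := ha.exists_walk_length_eq_dist
  obtain ⟨q, hq⟩ := hb.exists_walk_length_eq_dist
  have h1 := dist_le (p.concat hab)
  have h2 := dist_le (q.concat hab.symm)
  have h3 := c.even_length_iff_congr p
  have h4 := c.even_length_iff_congr q
  have h5 := c.valid hab
  rw [Walk.length_concat] at h1 h2
  rw [hp] at h1 h3
  rw [hq] at h2 h4
  have h6 : H.dist u a ≠ H.dist u b := by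
    intro h
    rw [h, h4] at h3
    revert h3 h5
    cases c u <;> cases c a <;> cases c b <;> simp
  omega

theorem GeodesicsInWalks.adj_of_dist (hH : GeodesicsInWalks H) {u x y v z : W} {n : ℕ}
    (hr : H.Reachable u z) (hz : H.dist u z = n) (hx : H.dist u x = n + 1)
    (hy : H.dist u y = n + 1) (hv : H.dist u v = n + 2)
    (hzx : H.Adj z x) (hxv : H.Adj x v) (hvy : H.Adj v y) : H.Adj z y := by
  classical
  obtain ⟨p, hp⟩ := hr.exists_walk_length_eq_dist
  obtain ⟨q, hqs, hq⟩ := hH (((p.concat hzx).concat hxv).concat hvy)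
  have hnil : ¬ q.Nil := by
    rw [← Walk.length_eq_zero_iff]; omega
  have hadj := q.adj_penultimate hnil
  have hd : H.dist u q.penultimate ≤ n := by
    have h1 := dist_le q.dropLast
    have h2 : q.dropLast.length + 1 = q.length := by
      rw [← Walk.length_concat _ hadj, Walk.concat_dropLast]
    omega
  have hmem := hqs (q.getVert_mem_support (q.length - 1))
  change q.penultimate ∈ _ at hmem
  simp only [Walk.support_concat, List.mem_append, List.mem_singleton]
    at hmem
  rcases hmem with ((hmem | h) | h) | h
  · have h1 := dist_le (p.takeUntil _ hmem)
    have h2 : H.dist u y ≤ (p.takeUntil _ hmem).length + 1 := by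
      simpa using dist_le ((p.takeUntil _ hmem).concat hadj)
    have h3 := congrArg Walk.length (p.take_spec hmem)
    rw [Walk.length_append] at h3
    have h4 : (p.dropUntil _ hmem).length = 0 := by omega
    rwa [Walk.eq_of_length_eq_zero h4] at hadj
  all_goals rw [h] at hd; omega

theorem GeodesicsInWalks.exists_pendant_or_twins [Finite W] [Nonempty W]
    (hH : GeodesicsInWalks H) (c : H.Coloring Bool) :
    ∃ v, (∀ a b, H.Adj v a → H.Adj v b → a = b) ∨
      ∃ w, w ≠ v ∧ (∃ a, H.Adj v a) ∧ ∀ a, H.Adj v a ↔ H.Adj w a := by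
  obtain ⟨u⟩ := ‹Nonempty W›
  obtain ⟨m, hm, hmax⟩ := Set.exists_max_image {v | H.Reachable u v} (H.dist u)
    (Set.toFinite _) ⟨u, Reachable.refl u⟩
  obtain ⟨v, ⟨hv, hvm⟩, hmin⟩ := Set.exists_min_image
    {v | H.Reachable u v ∧ H.dist u v = H.dist u m} (fun v => (H.neighborSet v).ncard)
    (Set.toFinite _) ⟨m, hm, rfl⟩
  by_cases hpend : ∀ a b, H.Adj v a → H.Adj v b → a = b
  · exact ⟨v, Or.inl hpend⟩
  push Not at hpend
  obtain ⟨x, y, hvx, hvy, hxy⟩ := hpend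
  have hdown : ∀ w a, H.Reachable u w → H.dist u w = H.dist u m → H.Adj w a →
      H.Reachable u a ∧ H.dist u a + 1 = H.dist u m := by
    intro w a hw hwm hwa
    have ha := hw.trans hwa.reachable
    have h1 := hmax a ha
    have h2 := c.dist_eq_add_one_or_of_adj hw hwa
    exact ⟨ha, by omega⟩
  have key : ∀ x y, x ≠ y → H.Adj v x → H.Adj v y → ∀ w, H.Adj x w → H.Adj y w := by
    intro x y hxy hvx hvy w hxw
    obtain ⟨hrx, hdx⟩ := hdown v x hv hvm hvx
    obtain ⟨hry, hdy⟩ := hdown v y hv hvm hvy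
    have hrw := hrx.trans hxw.reachable
    rcases c.dist_eq_add_one_or_of_adj hrx hxw with hdw | hdw
    · by_contra hyw
      have hsub : ¬ H.neighborSet w ⊂ H.neighborSet v := fun h =>
        (Set.ncard_lt_ncard h (Set.toFinite _)).not_ge (hmin w ⟨hrw, by omega⟩)
      obtain ⟨b, hwb, hvb⟩ : ∃ b, H.Adj w b ∧ ¬ H.Adj v b := by
        by_contra! h
        exact hsub ⟨fun b hb => h b hb, fun h' => hyw ((h' hvy).symm)⟩
      obtain ⟨hrb, hdb⟩ := hdown w b hrw (by omega) hwb
      have hpos : H.dist u x ≠ 0 := by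
        intro h0
        rw [hrx.dist_eq_zero_iff] at h0
        have h1 : H.dist u y = 0 := by rw [h0] at hdx hdy ⊢; simp at hdx; omega
        rw [hry.dist_eq_zero_iff] at h1
        exact hxy (h0.symm.trans h1)
      obtain ⟨p, hp⟩ := hrx.exists_walk_length_eq_dist
      have hnil : ¬ p.Nil := by
        rw [← Walk.length_eq_zero_iff]; omega
      have hzx := p.adj_penultimate hnil
      have hrz : H.Reachable u p.penultimate := ⟨p.dropLast⟩
      have hdz : H.dist u p.penultimate + 1 = H.dist u x := by
        have h1 := dist_le p.dropLast
        have h2 : p.dropLast.length + 1 = p.length := by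
          rw [← Walk.length_concat _ hzx, Walk.concat_dropLast]
        have := c.dist_eq_add_one_or_of_adj hrz hzx
        omega
      generalize p.penultimate = z at hzx hrz hdz
      have hzy : H.Adj z y := hH.adj_of_dist hrz rfl (by omega) (by omega) (v := v) (by omega)
        hzx hvx.symm hvy
      have hzb : H.Adj z b := hH.adj_of_dist hrz rfl (by omega) (by omega) (v := w) (by omega)
        hzx hxw hwb
      obtain ⟨q, hqs, hq⟩ := hH
        (Walk.cons hvy (Walk.cons hzy.symm (Walk.cons hzb (Walk.cons hwb.symm Walk.nil))))
      have hle : q.length ≤ 2 := by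
        rw [hq]
        exact dist_le (Walk.cons hvx (Walk.cons hxw Walk.nil))
      have hvw : ¬ H.Adj v w := by
        intro h
        have := c.dist_eq_add_one_or_of_adj hv h
        omega
      have hvz : ¬ H.Adj v z := by
        intro h
        have := c.dist_eq_add_one_or_of_adj hv h
        omega
      match q, hqs, hle with
      | .nil, _, _ => exact hyw hvy.symm
      | .cons h .nil, _, _ => exact hvw h
      | .cons (v := s) h (.cons h' .nil), hqs, _ =>
        have hs : s ∈ [v, y, z, b, w] := hqs (by simp)
        simp only [List.mem_cons, List.not_mem_nil, or_false] at hs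
        rcases hs with rfl | rfl | rfl | rfl | rfl
        · exact H.loopless.irrefl _ h
        · exact hyw h'
        · exact hvz h
        · exact hvb h
        · exact hvw h
      | .cons _ (.cons _ (.cons _ _)), _, hle => simp at hle
    · exact (hH.adj_of_dist hrw rfl (by omega) (by omega) (v := v) (by omega)
        hxw.symm hvx.symm hvy).symm
  exact ⟨x, Or.inr ⟨y, hxy.symm, ⟨v, hvx.symm⟩,
    fun w => ⟨key x y hxy hvx hvy w, key y x hxy.symm hvy hvx w⟩⟩⟩

end Pruning

/-- `le` is a partial order supported on `A` in which every down-set is a chain. -/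
structure IsForestOrder (A : Set V) (le : V → V → Prop) : Prop where
  mem : ∀ a b, le a b → a ∈ A ∧ b ∈ A
  refl : ∀ a ∈ A, le a a
  trans : ∀ a b c, le a b → le b c → le a c
  antisymm : ∀ a b, le a b → le b a → a = b
  chain : ∀ x a b, le a x → le b x → le a b ∨ le b a

/-- `B` is a nonempty closed interval of `le`. -/
def IsOrderInterval (le : V → V → Prop) (B : Set V) : Prop :=
  ∃ a b, le a b ∧ ∀ x, x ∈ B ↔ le a x ∧ le x b

theorem IsForestOrder.isOrderInterval_singleton {A : Set V} {le : V → V → Prop}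
    (h : IsForestOrder A le) {a : V} (ha : a ∈ A) : IsOrderInterval le {a} := by
  refine ⟨a, a, h.refl a ha, fun x => ⟨?_, fun hx => h.antisymm _ _ hx.2 hx.1⟩⟩
  rintro rfl
  exact ⟨h.refl _ ha, h.refl _ ha⟩

theorem IsForestOrder.exists_insert_leaf_below {A : Set V} {le : V → V → Prop}
    (h : IsForestOrder A le) {v : V} (hv : v ∉ A) {D : Set V} (hDA : D ⊆ A)
    (hD : ∀ a b, le a b → b ∈ D → a ∈ D) (hDc : ∀ a ∈ D, ∀ b ∈ D, le a b ∨ le b a) :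
    ∃ le', IsForestOrder (insert v A) le' ∧ (∀ a b, b ≠ v → (le' a b ↔ le a b)) ∧
      ∀ a, le' a v ↔ a = v ∨ a ∈ D := by
  have hm := h.mem
  have hr := h.refl
  have ht := h.trans
  have ha := h.antisymm
  have hc := h.chain
  refine ⟨fun a b => le a b ∨ (b = v ∧ (a = v ∨ a ∈ D)), ⟨?_, ?_, ?_, ?_, ?_⟩, ?_, ?_⟩
  · rintro a b (hab | ⟨rfl, rfl | haD⟩)
    · exact ⟨Or.inr (hm a b hab).1, Or.inr (hm a b hab).2⟩
    · exact ⟨Or.inl rfl, Or.inl rfl⟩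
    · exact ⟨Or.inr (hDA haD), Or.inl rfl⟩
  · rintro a (rfl | h)
    · simp
    · exact Or.inl (hr a h)
  · grind
  · grind
  · grind
  · grind
  · grind

theorem IsForestOrder.exists_insert_leaf {A : Set V} {le : V → V → Prop}
    (h : IsForestOrder A le) {v : V} (hv : v ∉ A) {B : Set V}
    (hB : B.Nonempty → IsOrderInterval le B) :
    ∃ le', IsForestOrder (insert v A) le' ∧
      (∀ C, IsOrderInterval le C → IsOrderInterval le' C) ∧
      IsOrderInterval le' (insert v B) := by
  have hkeep : ∀ le' : V → V → Prop, (∀ a b, b ≠ v → (le' a b ↔ le a b)) →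
      ∀ C, IsOrderInterval le C → IsOrderInterval le' C := by
    rintro le' hle' C ⟨a, b, hab, hC⟩
    have hm := h.mem
    refine ⟨a, b, ?_, ?_⟩ <;> grind
  by_cases hne : B.Nonempty
  · obtain ⟨a, b, hab, hBab⟩ := hB hne
    obtain ⟨le', hf, hle, hlev⟩ := h.exists_insert_leaf_below hv (D := {x | le x b})
      (fun x hx => (h.mem x b hx).1) (fun x y hxy hy => h.trans x y b hxy hy)
      (fun x hx y hy => h.chain b x y hx hy)
    have hm := h.mem
    refine ⟨le', hf, hkeep le' hle, a, v, (hlev a).2 (Or.inr hab), fun x => ?_⟩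
    grind
  · obtain ⟨le', hf, hle, -⟩ := h.exists_insert_leaf_below hv (D := ∅)
      (by simp) (by simp) (by simp)
    refine ⟨le', hf, hkeep le' hle, ?_⟩
    rw [Set.not_nonempty_iff_eq_empty.1 hne, insert_empty_eq]
    exact hf.isOrderInterval_singleton (Set.mem_insert _ _)

theorem IsForestOrder.exists_insert_twin {A : Set V} {le : V → V → Prop}
    (h : IsForestOrder A le) {v w : V} (hv : v ∉ A) (hw : w ∈ A) :
    ∃ le', IsForestOrder (insert v A) le' ∧
      ∀ B C, IsOrderInterval le B → (∀ x, x ≠ v → (x ∈ C ↔ x ∈ B)) → (v ∈ C ↔ w ∈ B) →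
        IsOrderInterval le' C := by
  classical
  have hm := h.mem
  have hr := h.refl
  have ht := h.trans
  have ha := h.antisymm
  have hc := h.chain
  have hvw : v ≠ w := fun h => hv (h ▸ hw)
  let f : V → V := fun a => if a = v then w else a
  have hfv : f v = w := if_pos rfl
  have hf : ∀ a, a ≠ v → f a = a := fun a h => if_neg h
  refine ⟨fun a b => le (f a) (f b) ∧ ¬ (a = v ∧ b = w), ⟨?_, ?_, ?_, ?_, ?_⟩, ?_⟩
  · grind
  · grind
  · grind
  · grind
  · grind
  · rintro B C ⟨a, b, hab, hB⟩ hC hCv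
    have hav : a ≠ v := fun h => hv (h ▸ (hm _ _ hab).1)
    have hbv : b ≠ v := fun h => hv (h ▸ (hm _ _ hab).2)
    by_cases hbw : b = w
    · refine ⟨a, v, ?_, ?_⟩ <;> grind
    · refine ⟨a, b, ?_, ?_⟩ <;> grind

theorem DistHereditary.exists_forestOrder [Finite V] {G : SimpleGraph V} {X Y : Set V}
    (hbip : IsBipartition G X Y) (hDH : DistHereditary G) (n : ℕ) :
    ∀ T : Set V, T.ncard = n → ∃ le, IsForestOrder (X ∩ T) le ∧
      ∀ y ∈ Y ∩ T, (G.neighborSet y ∩ T).Nonempty →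
        IsOrderInterval le (G.neighborSet y ∩ T) := by
  classical
  obtain ⟨hdisj, hcov, hadj⟩ := hbip
  have hYX : ∀ v, v ∈ Y → v ∉ X := fun v hy hx => Set.disjoint_left.1 hdisj hx hy
  have hXY : ∀ v, v ∈ X ∨ v ∈ Y := fun v => by
    rw [← Set.mem_union, hcov]; trivial
  have hadjY : ∀ y x, y ∈ Y → G.Adj y x → x ∈ X := fun y x hy hyx => by
    rcases hadj hyx with h | h
    · exact absurd h.1 (hYX y hy)
    · exact h.2
  have hadjX : ∀ x y, x ∈ X → G.Adj x y → y ∈ Y := fun x y hx hxy => by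
    rcases hadj hxy with h | h
    · exact h.2
    · exact absurd hx (hYX x h.1)
  induction n with
  | zero =>
    intro T hT
    obtain rfl : T = ∅ := (Set.ncard_eq_zero (Set.toFinite T)).1 hT
    exact ⟨fun _ _ => False, ⟨by simp, by simp, by simp, by simp, by simp⟩, by simp⟩
  | succ n ih =>
    intro T hT
    have : Nonempty T := (Set.ncard_pos (Set.toFinite T)).1 (by omega) |>.to_subtype
    let c : (G.induce T).Coloring Bool := Coloring.mk (fun v => decide (v.1 ∈ X)) (by
      intro v w hvw
      have hvw : G.Adj v w := hvw
      rcases hadj hvw with h | h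
      · simp [h.1, hYX _ h.2]
      · simp [h.2, hYX _ h.1])
    obtain ⟨⟨v, hv⟩, hprune⟩ := (hDH.geodesicsInWalks_induce T).exists_pendant_or_twins c
    obtain ⟨le, hle, hint⟩ := ih (T \ {v}) (by rw [Set.ncard_sdiff_singleton_of_mem hv]; omega)
    simp only [comap_adj, Function.Embedding.subtype_apply, Subtype.forall, Subtype.exists,
      Subtype.mk.injEq, ne_eq] at hprune
    rcases hXY v with hvX | hvY
    · have hvA : v ∉ X ∩ (T \ {v}) := by simp
      have hA : insert v (X ∩ (T \ {v})) = X ∩ T := by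
        ext a; by_cases h : a = v <;> simp [h, hvX, hv]
      rcases hprune with hpend | ⟨w, hw, hwv, ⟨z, hz, hvz⟩, htwin⟩
      · by_cases hnb : ∃ y ∈ T, G.Adj v y
        · obtain ⟨y, hy, hvy⟩ := hnb
          have hyv : y ≠ v := hvy.ne'
          obtain ⟨le', hle', hkeep, hB⟩ := hle.exists_insert_leaf hvA
            (hint y ⟨hadjX v y hvX hvy, hy, hyv⟩)
          rw [hA] at hle'
          refine ⟨le', hle', fun y' hy' hne => ?_⟩
          by_cases hyy : y' = y
          · subst hyy
            convert hB using 1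
            ext a; by_cases h : a = v <;> simp [h, hv, hvy.symm]
          · have heq : G.neighborSet y' ∩ T = G.neighborSet y' ∩ (T \ {v}) := by
              ext a
              have : a ∈ T → G.Adj y' a → a ≠ v := by
                rintro - h rfl
                exact hyy (hpend _ hy'.2 _ hy h.symm hvy)
              simp only [Set.mem_inter_iff, mem_neighborSet, Set.mem_sdiff, Set.mem_singleton_iff]
              tauto
            rw [heq] at hne ⊢
            exact hkeep _ (hint y' ⟨hy'.1, hy'.2, fun h => hYX _ hy'.1 (h ▸ hvX)⟩ hne)
        · push Not at hnb
          obtain ⟨le', hle', hkeep, -⟩ := hle.exists_insert_leaf hvA (B := ∅) (by simp)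
          rw [hA] at hle'
          refine ⟨le', hle', fun y' hy' hne => ?_⟩
          have heq : G.neighborSet y' ∩ T = G.neighborSet y' ∩ (T \ {v}) := by
            ext a
            have : G.Adj y' a → a ≠ v := by
              rintro h rfl
              exact hnb _ hy'.2 h.symm
            simp only [Set.mem_inter_iff, mem_neighborSet, Set.mem_sdiff, Set.mem_singleton_iff]
            tauto
          rw [heq] at hne ⊢
          exact hkeep _ (hint y' ⟨hy'.1, hy'.2, fun h => hYX _ hy'.1 (h ▸ hvX)⟩ hne)
      · have hwX : w ∈ X := hadjY z w (hadjX v z hvX hvz) ((htwin z hz).1 hvz).symm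
        obtain ⟨le', hle', hkeep⟩ := hle.exists_insert_twin hvA ⟨hwX, hw, hwv⟩
        rw [hA] at hle'
        refine ⟨le', hle', fun y hy hne => ?_⟩
        have hyt : G.Adj y v ↔ G.Adj y w := by
          rw [G.adj_comm y v, G.adj_comm y w]; exact htwin y hy.2
        refine hkeep (G.neighborSet y ∩ (T \ {v})) _
          (hint y ⟨hy.1, hy.2, fun h => hYX _ hy.1 (h ▸ hvX)⟩ ?_) ?_ ?_
        · obtain ⟨a, ha, haT⟩ := hne
          by_cases hav : a = v
          · subst hav
            exact ⟨w, hyt.1 ha, hw, hwv⟩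
          · exact ⟨a, ha, haT, hav⟩
        · intro x hx
          simp [hx]
        · simp [hv, hw, hwv, hyt]
    · have hA : X ∩ (T \ {v}) = X ∩ T := by
        ext a
        have : a ∈ X → a ≠ v := fun h h' => hYX v hvY (h' ▸ h)
        simp only [Set.mem_inter_iff, Set.mem_sdiff, Set.mem_singleton_iff]
        tauto
      rw [hA] at hle
      have hN : ∀ y ∈ Y, G.neighborSet y ∩ (T \ {v}) = G.neighborSet y ∩ T := by
        intro y hy
        ext a
        have : G.Adj y a → a ≠ v := fun h h' => hYX v hvY (h' ▸ hadjY y a hy h)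
        simp only [Set.mem_inter_iff, mem_neighborSet, Set.mem_sdiff, Set.mem_singleton_iff]
        tauto
      refine ⟨le, hle, fun y hy hne => ?_⟩
      by_cases hyv : y = v
      · subst hyv
        rcases hprune with hpend | ⟨w, hw, hwv, ⟨z, hz, hvz⟩, htwin⟩
        · obtain ⟨x, hyx, hx⟩ := hne
          have : G.neighborSet y ∩ T = {x} := by
            ext a
            refine ⟨fun ha => hpend a ha.2 x hx ha.1 hyx, ?_⟩
            rintro rfl
            exact ⟨hyx, hx⟩
          rw [this]
          exact hle.isOrderInterval_singleton ⟨hadjY y x hvY hyx, hx⟩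
        · have hwY : w ∈ Y := hadjX z w (hadjY y z hvY hvz) ((htwin z hz).1 hvz).symm
          have : G.neighborSet y ∩ T = G.neighborSet w ∩ T := by
            ext a
            simp only [Set.mem_inter_iff, mem_neighborSet]
            have := htwin a
            tauto
          rw [this] at hne ⊢
          rw [← hN w hwY] at hne ⊢
          exact hint w ⟨hwY, hw, hwv⟩ hne
      · rw [← hN y hy.1] at hne ⊢
        exact hint y ⟨hy.1, hy.2, hyv⟩ hne

/-- A connected BDH graph with an edge is a path-arborescence
bipartite graph: there is a forest partial order on `X` (down-sets are
chains, i.e. the ancestor order of an arborescence on the arcs `X`) such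
that the neighborhood of every `y ∈ Y` is an interval (a directed path). -/
theorem BDH_is_path_arborescence [Fintype V] (G : SimpleGraph V)
    (X Y : Set V) (hbip : IsBipartition G X Y) (hDH : DistHereditary G)
    (hconn : G.Connected) (hedge : ∃ u v, G.Adj u v) :
    ∃ le : ↥X → ↥X → Prop,
      (∀ a, le a a) ∧
      (∀ a b c, le a b → le b c → le a c) ∧
      (∀ a b, le a b → le b a → a = b) ∧
      (∀ x a b : ↥X, le a x → le b x → le a b ∨ le b a) ∧
      (∀ y : V, y ∈ Y → ∃ a b : ↥X, le a b ∧
        ∀ x : ↥X, G.Adj y ↑x ↔ (le a x ∧ le x b)) := by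
  obtain ⟨le, hle, hint⟩ := hDH.exists_forestOrder hbip _ Set.univ rfl
  simp only [Set.inter_univ] at hle hint
  refine ⟨fun a b => le a b, fun a => hle.refl a a.2, fun a b c => hle.trans a b c,
    fun a b hab hba => Subtype.ext (hle.antisymm a b hab hba), fun x a b => hle.chain x a b,
    fun y hy => ?_⟩
  have : Nontrivial V := by
    obtain ⟨u, v, huv⟩ := hedge
    exact ⟨u, v, huv.ne⟩
  obtain ⟨a, b, hab, hB⟩ := hint y hy (hconn.preconnected.exists_adj_of_nontrivial y)
  exact ⟨⟨a, (hle.mem a b hab).1⟩, ⟨b, (hle.mem a b hab).2⟩, hab, fun x => hB x⟩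
end
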